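/- arXiv:math/0609401 — 3 statements merged into one kernel-verified Lean document; each statement's English description precedes it below -/
import Mathlib

section
/- If X is a regular (T₃) topological space satisfying Δ(X) > pe(X), then X is ω-resolvable. -/
open Cardinal

/-- A space is `κ`-resolvable if it contains `κ` pairwise disjoint dense subsets. -/
def Resolvable (X : Type*) [TopologicalSpace X] (κ : Cardinal) : Prop :=
  ∃ D : Set (Set X), #D = κ ∧ (∀ d ∈ D, Dense d) ∧ D.PairwiseDisjoint id

/-- `Δ(X)`: the minimum cardinality of a nonempty open subset of `X`. -/
noncomputable def Delta (X : Type*) [TopologicalSpace X] : Cardinal :=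
  sInf {c : Cardinal | ∃ U : Set X, IsOpen U ∧ U.Nonempty ∧ #U = c}

/-- `X` is maximally resolvable if it is `Δ(X)`-resolvable. -/
def MaximallyResolvable (X : Type*) [TopologicalSpace X] : Prop :=
  Resolvable X (Delta X)

/-- pe(X): the smallest successor cardinal κ⁺ such that X has no closed discrete subset
of size κ⁺. -/
noncomputable def peInv (X : Type*) [TopologicalSpace X] : Cardinal :=
  sInf {c : Cardinal | (∃ κ : Cardinal, c = Order.succ κ) ∧
    ¬ ∃ D : Set X, IsClosed D ∧ DiscreteTopology D ∧ #D = c}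

open Set Topology

universe u

section SmallSets

variable {X : Type*} {μ : Cardinal}

theorem mk_union_le_of_le (hμ : ℵ₀ ≤ μ) {s t : Set X} (hs : #s ≤ μ) (ht : #t ≤ μ) :
    #(s ∪ t : Set X) ≤ μ :=
  (mk_union_le s t).trans (add_le_of_le hμ hs ht)

theorem mk_biUnion_le_of_forall_le {ι X : Type u} {μ : Cardinal.{u}} (hμ : ℵ₀ ≤ μ) {s : Set ι}
    {f : ι → Set X} (hs : #s ≤ μ) (hf : ∀ i ∈ s, #(f i) ≤ μ) : #(⋃ i ∈ s, f i) ≤ μ :=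
  (mk_biUnion_le f s).trans (mul_le_of_le hμ hs (ciSup_le' fun i => hf i i.2))

theorem mk_iUnion_nat_le_of_le (hμ : ℵ₀ ≤ μ) {f : ℕ → Set X} (hf : ∀ n, #(f n) ≤ μ) :
    #(⋃ n, f n) ≤ μ := by
  rw [← lift_le.{0}]
  refine (mk_iUnion_le_lift f).trans (mul_le_of_le (by simpa using hμ) (by simpa using hμ) ?_)
  exact ciSup_le' fun i => lift_le.2 (hf i)

theorem pairwise_disjoint_diff_succ {S : ℕ → Set X} (hS : Monotone S) :
    Pairwise (Function.onFun Disjoint fun n => S (n + 1) \ S n) := by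
  refine (pairwise_disjoint_on _).2 fun m n hmn => disjoint_left.2 fun p hp hp' => ?_
  exact hp'.2 (hS (Nat.succ_le_of_lt hmn) hp.1)

/-- A set of size greater than `μ` has a subset of size `μ` on which countably many functions with
fibers of size at most `μ` are all injective. -/
theorem exists_subset_injOn_of_mk_fiber_le (hμ : ℵ₀ ≤ μ) {A : Set X}
    (hA : μ < #A) (ρ : ℕ → X → X) (hρ : ∀ k a, #(ρ k ⁻¹' {a}) ≤ μ) :
    ∃ E ⊆ A, #E = μ ∧ ∀ k, InjOn (ρ k) E := by
  obtain ⟨M, hM⟩ := zorn_subset {M : Set X | M ⊆ A ∧ ∀ k, InjOn (ρ k) M} (by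
    intro c hc hchain
    refine ⟨⋃₀ c, ⟨sUnion_subset fun s hs => (hc hs).1, fun k => ?_⟩,
      fun s hs => subset_sUnion_of_mem hs⟩
    rintro x ⟨s, hs, hx⟩ y ⟨t, ht, hy⟩ hxy
    obtain ⟨r, hr, hsr, htr⟩ := hchain.directedOn s hs t ht
    exact (hc hr).2 k (hsr hx) (htr hy) hxy)
  obtain ⟨⟨hMA, hMinj⟩, hmax⟩ := hM
  have hle : μ ≤ #M := by
    by_contra! hlt
    have hsub : A ⊆ ⋃ k, ⋃ m ∈ M, ρ k ⁻¹' {ρ k m} := by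
      intro a ha
      by_contra hna
      simp only [mem_iUnion, mem_preimage, mem_singleton_iff, not_exists] at hna
      have haM : a ∈ M := hmax (y := insert a M) ⟨insert_subset ha hMA, fun k => by
        rintro x (rfl | hx) y (rfl | hy) hxy
        · rfl
        · exact absurd hxy (hna k y hy)
        · exact absurd hxy.symm (hna k x hx)
        · exact hMinj k hx hy hxy⟩ (subset_insert _ _) (mem_insert _ _)
      exact hna 0 a haM rfl
    refine hA.not_ge ((mk_le_mk_of_subset hsub).trans (mk_iUnion_nat_le_of_le hμ fun k => ?_))
    exact mk_biUnion_le_of_forall_le hμ hlt.le fun m _ => hρ k _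
  obtain ⟨E, hEM, hE⟩ := le_mk_iff_exists_subset.1 hle
  exact ⟨E, hEM.trans hMA, hE, fun k => (hMinj k).mono hEM⟩

end SmallSets

section Accessible

variable {X : Type*} [TopologicalSpace X] {μ : Cardinal}

/-- A point is `μ`-accessible from `Y` if, after removing any set of size at most `μ` from `Y`,
it still lies in the closure of a subset of what is left, of size at most `μ`. -/
def SmallAccessible (μ : Cardinal) (Y : Set X) (p : X) : Prop :=
  ∀ B : Set X, #B ≤ μ → ∃ C ⊆ Y, Disjoint C B ∧ #C ≤ μ ∧ p ∈ closure C

/-- There is a sequence of pairwise disjoint sets, each of which is dense in `V`. -/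
def HasDisjointDenseSeq (V : Set X) : Prop :=
  ∃ D : ℕ → Set X, Pairwise (Function.onFun Disjoint D) ∧ ∀ n, V ⊆ closure (D n)

/-- `M'` witnesses the accessibility and the inaccessibility from `Y` of every point of `M`. -/
structure IsSmallWitness (μ : Cardinal) (Y M M' : Set X) : Prop where
  subset : M ⊆ M'
  mem_closure : ∀ p ∈ M, SmallAccessible μ Y p → p ∈ closure (Y ∩ (M' \ M))
  notMem_closure : ∀ p ∈ M, ¬ SmallAccessible μ Y p →
    ∀ C ⊆ Y, Disjoint C M' → #C ≤ μ → p ∉ closure C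

theorem exists_isSmallWitness (hμ : ℵ₀ ≤ μ) (Y : Set X) {M : Set X} (hM : #M ≤ μ) :
    ∃ M' : Set X, #M' ≤ μ ∧ IsSmallWitness μ Y M M' := by
  have key : ∀ p : X, ∃ N : Set X, #N ≤ μ ∧
      (SmallAccessible μ Y p → N ⊆ Y ∧ Disjoint N M ∧ p ∈ closure N) ∧
      (¬ SmallAccessible μ Y p → ∀ C ⊆ Y, Disjoint C N → #C ≤ μ → p ∉ closure C) := by
    intro p
    by_cases hp : SmallAccessible μ Y p
    · obtain ⟨C, hCY, hCM, hC, hpC⟩ := hp M hM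
      exact ⟨C, hC, fun _ => ⟨hCY, hCM, hpC⟩, fun h => absurd hp h⟩
    · have hp' := hp
      unfold SmallAccessible at hp'
      push Not at hp'
      obtain ⟨B, hB, h⟩ := hp'
      exact ⟨B, hB, fun h => absurd h hp, fun _ => h⟩
  choose N hN hacc hnacc using key
  have hU : #(⋃ p ∈ M, N p) ≤ μ := mk_biUnion_le_of_forall_le hμ hM fun p _ => hN p
  refine ⟨M ∪ ⋃ p ∈ M, N p, mk_union_le_of_le hμ hM hU, subset_union_left, ?_, ?_⟩
  · intro p hp h
    obtain ⟨h1, h2, h3⟩ := hacc p h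
    have hsub : N p ⊆ Y ∩ ((M ∪ ⋃ p ∈ M, N p) \ M) := fun q hq =>
      ⟨h1 hq, Or.inr (mem_biUnion hp hq), disjoint_left.1 h2 hq⟩
    exact closure_mono hsub h3
  · intro p hp h C hC hd
    exact hnacc p h C hC (hd.mono_right ((subset_biUnion_of_mem hp).trans subset_union_right))

theorem exists_seq_isSmallWitness (hμ : ℵ₀ ≤ μ) (Y : Set X) {A : Set X} (hA : #A ≤ μ) :
    ∃ S : ℕ → Set X, S 0 = A ∧ (∀ n, #(S n) ≤ μ) ∧ ∀ n, IsSmallWitness μ Y (S n) (S (n + 1)) := by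
  have key : ∀ M : {M : Set X // #M ≤ μ}, ∃ M' : {M : Set X // #M ≤ μ},
      IsSmallWitness μ Y M.1 M'.1 := fun M =>
    let ⟨M', h, h'⟩ := exists_isSmallWitness hμ Y M.2
    ⟨⟨M', h⟩, h'⟩
  choose F hF using key
  let T : ℕ → {M : Set X // #M ≤ μ} := fun n => Nat.rec ⟨A, hA⟩ (fun _ M => F M) n
  exact ⟨fun n => (T n).1, rfl, fun n => (T n).2, fun n => hF (T n)⟩

theorem hasDisjointDenseSeq_of_small (hμ : ℵ₀ ≤ μ) {Y W V : Set X} (hW : #W ≤ μ)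
    (hacc : ∀ p ∈ W, SmallAccessible μ Y p) (hV : V ⊆ closure W) : HasDisjointDenseSeq V := by
  obtain ⟨S, h0, -, hS⟩ := exists_seq_isSmallWitness hμ Y hW
  have hmono : Monotone S := monotone_nat_of_le_succ fun n => (hS n).subset
  refine ⟨fun n => Y ∩ (S (n + 1) \ S n), ?_, fun n => ?_⟩
  · exact (pairwise_disjoint_diff_succ hmono).mono fun i j h =>
      h.mono inter_subset_right inter_subset_right
  · refine hV.trans (closure_minimal (fun p hp => ?_) isClosed_closure)
    exact (hS n).mem_closure p (hmono (Nat.zero_le n) (h0 ▸ hp)) (hacc p hp)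

/-- If every nonempty open set contains a nonempty open set with a disjoint dense sequence, then
so does the whole space. -/
theorem hasDisjointDenseSeq_univ
    (h : ∀ V : Set X, IsOpen V → V.Nonempty →
      ∃ V' ⊆ V, IsOpen V' ∧ V'.Nonempty ∧ HasDisjointDenseSeq V') :
    HasDisjointDenseSeq (univ : Set X) := by
  obtain ⟨F, hF⟩ := zorn_subset
    {F : Set (Set X) | (∀ V ∈ F, IsOpen V ∧ HasDisjointDenseSeq V) ∧ F.PairwiseDisjoint id} (by
      intro c hc hchain
      refine ⟨⋃₀ c, ⟨?_, ?_⟩, fun s hs => subset_sUnion_of_mem hs⟩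
      · rintro V ⟨s, hs, hV⟩
        exact (hc hs).1 V hV
      · exact (pairwiseDisjoint_sUnion hchain.directedOn).2 fun s hs => (hc hs).2)
  obtain ⟨⟨hF1, hF2⟩, hmax⟩ := hF
  choose! D hD hDd using fun V hV => (hF1 V hV).2
  refine ⟨fun n => ⋃ V ∈ F, D V n ∩ V, fun m n hmn => ?_, fun n => ?_⟩
  · simp only [Function.onFun, disjoint_iUnion_left, disjoint_iUnion_right]
    intro V hV W hW
    by_cases hVW : V = W
    · subst hVW
      exact (hD V hV hmn).mono inter_subset_left inter_subset_left
    · exact (hF2 hW hV (Ne.symm hVW)).mono inter_subset_right inter_subset_right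
  · have hsub : ∀ V ∈ F, V ⊆ closure (⋃ V ∈ F, D V n ∩ V) := fun V hV p hp => by
      have hp' : p ∈ closure (D V n ∩ V) := by
        rw [inter_comm]
        exact (hF1 V hV).1.inter_closure ⟨hp, hDd V hV n hp⟩
      exact closure_mono (subset_biUnion_of_mem (u := fun V => D V n ∩ V) hV) hp'
    by_contra hne
    obtain ⟨V', hV', hV'o, hV'n, hV'd⟩ := h (closure (⋃ V ∈ F, D V n ∩ V))ᶜ
      isClosed_closure.isOpen_compl (by
        rw [nonempty_compl]
        exact fun h => hne h.ge)
    have hdisj : ∀ V ∈ F, Disjoint V' V := fun V hV =>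
      disjoint_left.2 fun p hp hpV => hV' hp (hsub V hV hpV)
    have hmem : V' ∈ F := hmax (y := insert V' F) ⟨by
      rintro V (rfl | hV)
      exacts [⟨hV'o, hV'd⟩, hF1 V hV], hF2.insert fun V hV _ => hdisj V hV⟩
        (subset_insert _ _) (mem_insert _ _)
    exact hV'n.ne_empty (disjoint_self.1 (hdisj V' hmem))

theorem HasDisjointDenseSeq.resolvable [Nonempty X]
    (h : HasDisjointDenseSeq (univ : Set X)) : Resolvable X ℵ₀ := by
  obtain ⟨D, hD, hd⟩ := h
  have hdense : ∀ n, Dense (D n) := fun n => dense_iff_closure_eq.2 (univ_subset_iff.1 (hd n))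
  have hinj : Function.Injective D := fun m n hmn => by
    by_contra hne
    have := hD hne
    rw [Function.onFun, hmn, disjoint_self] at this
    exact (hdense n).nonempty.ne_empty this
  refine ⟨range D, ?_, ?_, ?_⟩
  · have := mk_range_eq_of_injective hinj
    simpa using this
  · rintro _ ⟨n, rfl⟩
    exact hdense n
  · rintro _ ⟨m, rfl⟩ _ ⟨n, rfl⟩ hne
    exact hD fun h => hne (h ▸ rfl)

/-- A rank function adapted to `Y`: its fibers are small, small subsets of `Y` of larger rank do
not accumulate at inaccessible points, and the accessible points that are not limits of points of
`Y` of smaller rank are limits of infinitely many disjoint sets. -/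
structure IsAccessRank [LinearOrder X] (μ : Cardinal) (Y : Set X) (ρ : X → X) : Prop where
  mk_fiber_le : ∀ a, #(ρ ⁻¹' {a}) ≤ μ
  notMem_closure : ∀ p, ¬ SmallAccessible μ Y p → ∀ C ⊆ Y, #C ≤ μ → (∀ q ∈ C, ρ p < ρ q) →
    p ∉ closure C
  hasDisjointDenseSeq : HasDisjointDenseSeq
    {p | SmallAccessible μ Y p ∧ p ∉ closure (Y ∩ {q | ρ q < ρ p})}

theorem exists_isAccessRank [LinearOrder X] [WellFoundedLT X] (hμ : ℵ₀ ≤ μ) (Y : Set X) :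
    ∃ ρ : X → X, IsAccessRank μ Y ρ := by
  have hs : ∀ x : X, #({x} : Set X) ≤ μ := fun x => by
    rw [mk_singleton]
    exact one_le_aleph0.trans hμ
  choose S hS0 hSμ hS using fun x => exists_seq_isSmallWitness hμ Y (hs x)
  have hmono : ∀ x, Monotone (S x) := fun x => monotone_nat_of_le_succ fun n => (hS x n).subset
  have key : ∀ p : X, ∃ x, (∃ n, p ∈ S x n) ∧ ∀ y n, p ∈ S y n → x ≤ y := by
    intro p
    obtain ⟨x, hx, hmin⟩ := WellFounded.has_min (wellFounded_lt (α := X)) {x | ∃ n, p ∈ S x n}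
      ⟨p, 0, by simp [hS0]⟩
    exact ⟨x, hx, fun y n hy => not_lt.1 (hmin y ⟨n, hy⟩)⟩
  choose ρ hρ hle using key
  refine ⟨ρ, fun a => ?_, fun p hp C hC hCμ hlt => ?_, ?_⟩
  · refine (mk_le_mk_of_subset ?_).trans (mk_iUnion_nat_le_of_le hμ (hSμ a))
    rintro p rfl
    exact mem_iUnion.2 (hρ p)
  · obtain ⟨n, hn⟩ := hρ p
    refine (hS (ρ p) n).notMem_closure p hn hp C hC (disjoint_left.2 fun q hq hq' => ?_) hCμ
    exact (hlt q hq).not_ge (hle q _ _ hq')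
  · refine ⟨fun i => {q | ∃ m, (Nat.unpair m).1 = i ∧ q ∈ S (ρ q) (m + 1) \ S (ρ q) m},
      fun i j hij => disjoint_left.2 ?_, ?_⟩
    · rintro q ⟨m, rfl, hm⟩ ⟨m', rfl, hm'⟩
      have hne : m ≠ m' := fun h => hij (h ▸ rfl)
      exact disjoint_left.1 (pairwise_disjoint_diff_succ (hmono (ρ q)) hne) hm hm'
    · rintro i p ⟨hp, hpL⟩
      obtain ⟨n, hn⟩ := hρ p
      have h1 := (hS (ρ p) (Nat.pair i n)).mem_closure p
        (hmono _ (Nat.right_le_pair i n) hn) hp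
      refine Or.resolve_left ?_ hpL
      rw [← mem_union, ← closure_union]
      refine closure_mono (fun q hq => ?_) h1
      rcases (hle q _ _ hq.2.1).lt_or_eq with hlt | heq
      · exact Or.inl ⟨hq.1, hlt⟩
      · refine Or.inr ⟨Nat.pair i n, by simp, ?_⟩
        rw [heq]
        exact hq.2

end Accessible

section Accumulation

variable {X : Type*} [TopologicalSpace X] {μ : Cardinal}

theorem exists_mem_closure_diff_singleton [T1Space X]
    (hμ : ¬ ∃ D : Set X, IsClosed D ∧ DiscreteTopology D ∧ #D = μ) {E : Set X} (hE : #E = μ) :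
    ∃ p, p ∈ closure (E \ {p}) := by
  by_contra! hno
  have hacc : ∀ p, ¬ AccPt p (Filter.principal E) := fun p hp => hno p (by
    rw [accPt_principal_iff_clusterPt, ← mem_closure_iff_clusterPt] at hp
    exact hp)
  refine hμ ⟨E, isClosed_iff_accPt.2 fun p hp => absurd hp (hacc p), ?_, hE⟩
  exact discreteTopology_of_noAccPts fun p _ => hacc p

theorem aleph0_le_of_not_exists_closed_discrete [T1Space X]
    (hμ : ¬ ∃ D : Set X, IsClosed D ∧ DiscreteTopology D ∧ #D = μ) (hX : μ ≤ #X) : ℵ₀ ≤ μ := by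
  by_contra! hlt
  obtain ⟨E, hE⟩ := le_mk_iff_exists_set.1 hX
  have hfin : E.Finite := lt_aleph0_iff_set_finite.1 (hE.symm ▸ hlt)
  have := hfin.to_subtype
  exact hμ ⟨E, hfin.isClosed, inferInstance, hE⟩

end Accumulation

section Tower

variable {X : Type*} [TopologicalSpace X] {μ : Cardinal}

/-- The points of `Y` that are limits of points of `Y` of smaller rank. -/
def rankLimits [LinearOrder X] (Y : Set X) (ρ : X → X) : Set X :=
  {p ∈ Y | p ∈ closure (Y ∩ {q | ρ q < ρ p})}

theorem IsAccessRank.mem_closure_of_injOn [LinearOrder X] [T1Space X] {Y E : Set X} {ρ : X → X}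
    (hρ : IsAccessRank μ Y ρ) (hEY : E ⊆ Y) (hE : #E ≤ μ) (hinj : InjOn ρ E) {p : X}
    (hp : p ∈ closure (E \ {p})) (hpY : ¬ SmallAccessible μ Y p) :
    p ∈ closure (Y ∩ {q | ρ q < ρ p}) := by
  have hsub : E \ {p} ⊆ (Y ∩ {q | ρ q < ρ p}) ∪
      ({q ∈ E | ρ p < ρ q} ∪ {q ∈ E \ {p} | ρ q = ρ p}) := by
    intro q hq
    rcases lt_trichotomy (ρ q) (ρ p) with h | h | h
    · exact Or.inl ⟨hEY hq.1, h⟩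
    · exact Or.inr (Or.inr ⟨hq, h⟩)
    · exact Or.inr (Or.inl ⟨hq.1, h⟩)
  have hp' := closure_mono hsub hp
  rw [closure_union, closure_union] at hp'
  rcases hp' with h | h | h
  · exact h
  · refine absurd h (hρ.notMem_closure p hpY _ (fun q hq => hEY hq.1)
      ((mk_le_mk_of_subset fun q hq => hq.1).trans hE) fun q hq => hq.2)
  · have hss : {q ∈ E \ {p} | ρ q = ρ p}.Subsingleton := fun x hx y hy =>
      hinj hx.1.1 hy.1.1 (hx.2.trans hy.2.symm)
    rw [hss.isClosed.closure_eq] at h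
    exact absurd rfl h.1.2

/-- In an open set without disjoint dense sequences, finitely many sets with disjoint dense
sequences can be avoided by shrinking. -/
theorem exists_open_disjoint_of_hasDisjointDenseSeq {U V : Set X}
    (hU : ∀ V ⊆ U, IsOpen V → V.Nonempty → ¬ HasDisjointDenseSeq V)
    (hVU : V ⊆ U) (hV : IsOpen V) (hVn : V.Nonempty) (β : ℕ → Set X)
    (hβ : ∀ k, HasDisjointDenseSeq (β k)) (n : ℕ) :
    ∃ W ⊆ V, IsOpen W ∧ W.Nonempty ∧ ∀ k < n, Disjoint W (β k) := by
  induction n with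
  | zero => exact ⟨V, Subset.rfl, hV, hVn, by simp⟩
  | succ n ih =>
    obtain ⟨W, hWV, hWo, hWn, hW⟩ := ih
    obtain ⟨D, hD, hd⟩ := hβ n
    have hne : (W \ closure (β n)).Nonempty := by
      rw [sdiff_nonempty]
      intro h
      exact hU W (hWV.trans hVU) hWo hWn
        ⟨D, hD, fun m => h.trans (closure_minimal (hd m) isClosed_closure)⟩
    refine ⟨W \ closure (β n), sdiff_subset.trans hWV, hWo.sdiff isClosed_closure, hne, ?_⟩
    intro k hk
    rcases Nat.lt_succ_iff_lt_or_eq.1 hk with h | rfl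
    · exact (hW k h).mono_left sdiff_subset
    · exact disjoint_sdiff_left.mono_right subset_closure

theorem mk_lt_inter_rankLimits [LinearOrder X] [T3Space X] (hμ : ℵ₀ ≤ μ)
    (hacc : ∀ E : Set X, #E = μ → ∃ p, p ∈ closure (E \ {p})) {U : Set X}
    (hU : ∀ V ⊆ U, IsOpen V → V.Nonempty → ¬ HasDisjointDenseSeq V)
    {Y : ℕ → Set X} {ρ : ℕ → X → X} (hρ : ∀ n, IsAccessRank μ (Y n) (ρ n)) (h0 : Y 0 = Set.univ)
    (hY : ∀ n, Y (n + 1) = rankLimits (Y n) (ρ n)) (n : ℕ)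
    (ih : ∀ V ⊆ U, IsOpen V → V.Nonempty → μ < #(V ∩ Y n : Set X))
    {V : Set X} (hVU : V ⊆ U) (hV : IsOpen V) (hVn : V.Nonempty) :
    μ < #(V ∩ Y (n + 1) : Set X) := by
  by_contra! hZ
  set Z : Set X := V ∩ Y (n + 1) with hZdef
  have hanti : Antitone Y := antitone_nat_of_succ_le fun k => by
    rw [hY k]
    exact fun p hp => hp.1
  obtain ⟨W, hWV, hWo, hWn, hW⟩ := exists_open_disjoint_of_hasDisjointDenseSeq hU hVU hV hVn
    (fun k => {p | SmallAccessible μ (Y k) p ∧ p ∉ closure (Y k ∩ {q | ρ k q < ρ k p})})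
    (fun k => (hρ k).hasDisjointDenseSeq) (n + 1)
  obtain ⟨W', hW'W, hW'o, hW'n, hW'⟩ := exists_open_disjoint_of_hasDisjointDenseSeq hU
    (hWV.trans hVU) hWo hWn (fun _ => {z ∈ Z | SmallAccessible μ (Y n) z})
    (fun _ => hasDisjointDenseSeq_of_small hμ ((mk_le_mk_of_subset fun z hz => hz.1).trans hZ)
      (fun p hp => hp.2) subset_closure) 1
  obtain ⟨x, hx⟩ := hW'n
  obtain ⟨F, hFx, hFc, hFW⟩ := exists_mem_nhds_isClosed_subset (hW'o.mem_nhds hx)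
  obtain ⟨M', hM'μ, hM'⟩ := exists_isSmallWitness hμ (Y n) hZ
  have hA : μ < #((interior F ∩ Y n) \ M' : Set X) := by
    by_contra! hle
    refine (ih (interior F) ?_ isOpen_interior ⟨x, mem_interior_iff_mem_nhds.2 hFx⟩).not_ge ?_
    · exact interior_subset.trans (hFW.trans (hW'W.trans (hWV.trans hVU)))
    · exact (mk_le_mk_of_subset fun q hq => by
        by_cases h : q ∈ M'
        exacts [Or.inr h, Or.inl ⟨hq, h⟩]).trans (mk_union_le_of_le hμ hle hM'μ)
  obtain ⟨E, hEA, hE, hinj⟩ := exists_subset_injOn_of_mk_fiber_le hμ hA ρ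
    fun k => (hρ k).mk_fiber_le
  obtain ⟨p, hp⟩ := hacc E hE
  have hpW' : p ∈ W' := hFW (hFc.closure_subset_iff.2
    (fun q hq => interior_subset (hEA hq.1).1.1) hp)
  have hlim : ∀ k < n + 1, p ∈ closure (Y k ∩ {q | ρ k q < ρ k p}) := by
    intro k hk
    by_cases hpk : SmallAccessible μ (Y k) p
    · by_contra hnot
      exact disjoint_left.1 (hW k hk) (hW'W hpW') ⟨hpk, hnot⟩
    · exact (hρ k).mem_closure_of_injOn
        (fun q hq => hanti (Nat.lt_succ_iff.1 hk) (hEA hq).1.2) hE.le (hinj k) hp hpk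
  have hpY : ∀ k ≤ n + 1, p ∈ Y k := by
    intro k
    induction k with
    | zero => simp [h0]
    | succ k ihk =>
      intro hk
      rw [hY]
      exact ⟨ihk (by omega), hlim k hk⟩
  have hpZ : p ∈ Z := ⟨hWV (hW'W hpW'), hpY _ le_rfl⟩
  have hpn : ¬ SmallAccessible μ (Y n) p := fun h =>
    disjoint_left.1 (hW' 0 one_pos) hpW' ⟨hpZ, h⟩
  exact hM'.notMem_closure p hpZ hpn E (fun q hq => (hEA hq).1.2)
    (disjoint_left.2 fun q hq => (hEA hq).2) hE.le (closure_mono sdiff_subset hp)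

theorem exists_hasDisjointDenseSeq [T3Space X] (hμ : ℵ₀ ≤ μ)
    (hacc : ∀ E : Set X, #E = μ → ∃ p, p ∈ closure (E \ {p}))
    (hbig : ∀ V : Set X, IsOpen V → V.Nonempty → μ < #V) {U : Set X} (hUo : IsOpen U)
    (hUn : U.Nonempty) :
    ∃ V ⊆ U, IsOpen V ∧ V.Nonempty ∧ HasDisjointDenseSeq V := by
  by_contra! hU
  obtain ⟨_, _⟩ := exists_wellFoundedLT X
  choose r hr using fun Y : Set X => exists_isAccessRank hμ Y
  let Y : ℕ → Set X := fun n => Nat.rec univ (fun _ Y => rankLimits Y (r Y)) n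
  have hY : ∀ n, Y (n + 1) = rankLimits (Y n) (r (Y n)) := fun n => rfl
  have hcard : ∀ n, ∀ V ⊆ U, IsOpen V → V.Nonempty → μ < #(V ∩ Y n : Set X) := by
    intro n
    induction n with
    | zero =>
      intro V _ hV hVn
      change μ < #(V ∩ univ : Set X)
      rw [inter_univ]
      exact hbig V hV hVn
    | succ n ih =>
      intro V hVU hV hVn
      exact mk_lt_inter_rankLimits hμ hacc hU (fun n => hr (Y n)) rfl hY n ih hVU hV hVn
  have hanti : Antitone Y := antitone_nat_of_succ_le fun k p hp => hp.1
  refine hU U Subset.rfl hUo hUn ⟨fun n => Y n \ Y (n + 1), ?_, fun n x hx => ?_⟩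
  · refine (pairwise_disjoint_on _).2 fun m n hmn => disjoint_left.2 fun p hp hp' => ?_
    exact hp.2 (hanti (Nat.succ_le_of_lt hmn) hp'.1)
  · refine mem_closure_iff.2 fun V hV hxV => ?_
    have hne : (V ∩ U ∩ Y n).Nonempty := by
      have := zero_le.trans_lt
        (hcard n (V ∩ U) inter_subset_right (hV.inter hUo) ⟨x, hxV, hx⟩)
      rwa [pos_iff_ne_zero, mk_ne_zero_iff, nonempty_coe_sort] at this
    obtain ⟨p, hp, hmin⟩ := (InvImage.wf (r (Y n)) (wellFounded_lt (α := X))).has_min _ hne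
    refine ⟨p, hp.1.1, hp.2, fun hp' => ?_⟩
    obtain ⟨q, hqV, hqY, hq⟩ := mem_closure_iff.1 hp'.2 (V ∩ U) (hV.inter hUo) hp.1
    exact hmin q ⟨hqV, hqY⟩ hq

end Tower

/-- If X is regular (T₃) and Δ(X) > pe(X), then X is ω-resolvable. -/
theorem omega_resolvable_of_delta_gt_pe (X : Type*) [TopologicalSpace X] [T3Space X]
    (h : peInv X < Delta X) : Resolvable X Cardinal.aleph0 := by
  have hpe : ¬ ∃ D : Set X, IsClosed D ∧ DiscreteTopology D ∧ #D = peInv X := by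
    refine (csInf_mem (s := {c : Cardinal | (∃ κ : Cardinal, c = Order.succ κ) ∧
      ¬ ∃ D : Set X, IsClosed D ∧ DiscreteTopology D ∧ #D = c})
      ⟨Order.succ #X, ⟨#X, rfl⟩, ?_⟩).2
    rintro ⟨D, -, -, hD⟩
    exact (Order.lt_succ #X).not_ge (hD ▸ mk_set_le D)
  have hbig : ∀ V : Set X, IsOpen V → V.Nonempty → peInv X < #V := fun V hV hVn =>
    h.trans_le (csInf_le' ⟨V, hV, hVn, rfl⟩)
  have hX : Nonempty X := by
    by_contra hX
    rw [not_nonempty_iff] at hX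
    have hD : Delta X = 0 := by
      rw [Delta, ← Cardinal.sInf_empty]
      congr 1
      exact eq_empty_of_forall_notMem fun c ⟨U, _, hU, _⟩ => hU.elim fun x _ => hX.elim x
    exact not_lt_zero (hD ▸ h)
  have hμ : ℵ₀ ≤ peInv X := aleph0_le_of_not_exists_closed_discrete hpe
    (by simpa using (hbig univ isOpen_univ univ_nonempty).le)
  exact (hasDisjointDenseSeq_univ fun V hV hVn => exists_hasDisjointDenseSeq hμ
    (fun E hE => exists_mem_closure_diff_singleton hpe hE) hbig hV hVn).resolvable
end

section
/- Every separable monotonically normal compact Hausdorff space admits a continuous map onto a separable metric space such that every fiber of the map has cardinality at most 2. -/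
/-- A (T₁) space is monotonically normal if there is an operator H assigning to each pair
(x, U) with x ∈ U open an open set H x U with x ∈ H x U ⊆ U, such that
H x U ∩ H y V ≠ ∅ implies x ∈ V or y ∈ U. -/
def MonotonicallyNormal (X : Type*) [TopologicalSpace X] : Prop :=
  ∃ H : X → Set X → Set X,
    (∀ x U, IsOpen U → x ∈ U → IsOpen (H x U) ∧ x ∈ H x U ∧ H x U ⊆ U) ∧
    (∀ x U y V, IsOpen U → x ∈ U → IsOpen V → y ∈ V →
      (H x U ∩ H y V).Nonempty → x ∈ V ∨ y ∈ U)

/-- A space is crowded if it has no isolated points. -/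
def Crowded (X : Type*) [TopologicalSpace X] : Prop :=
  ∀ x : X, Filter.NeBot (nhdsWithin x {x}ᶜ)

open Set Filter Topology

/-- The property of an operator `H` that witnesses monotone normality. -/
structure IsMonotoneNormalityOperator {X : Type*} [TopologicalSpace X]
    (H : X → Set X → Set X) : Prop where
  isOpen : ∀ {x U}, IsOpen U → x ∈ U → IsOpen (H x U)
  mem : ∀ {x U}, IsOpen U → x ∈ U → x ∈ H x U
  subset : ∀ {x U}, IsOpen U → x ∈ U → H x U ⊆ U
  mem_or_mem : ∀ {x U y V z}, IsOpen U → x ∈ U → IsOpen V → y ∈ V →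
    z ∈ H x U → z ∈ H y V → x ∈ V ∨ y ∈ U

theorem MonotonicallyNormal.exists_operator {X : Type*} [TopologicalSpace X]
    (h : MonotonicallyNormal X) : ∃ H : X → Set X → Set X, IsMonotoneNormalityOperator H := by
  obtain ⟨H, h₁, h₂⟩ := h
  exact ⟨H, fun hU hx => (h₁ _ _ hU hx).1, fun hU hx => (h₁ _ _ hU hx).2.1,
    fun hU hx => (h₁ _ _ hU hx).2.2,
    fun hU hx hV hy hz hz' => h₂ _ _ _ _ hU hx hV hy ⟨_, hz, hz'⟩⟩

namespace IsMonotoneNormalityOperator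

variable {X : Type*} [TopologicalSpace X] {H : X → Set X → Set X}

/-- A separable monotonically normal space is countably tight. -/
theorem exists_countable_mem_closure [T1Space X] [TopologicalSpace.SeparableSpace X]
    (hH : IsMonotoneNormalityOperator H) {c : X} {S : Set X} (hc : c ∈ closure S) :
    ∃ N ⊆ S, N.Countable ∧ c ∈ closure N := by
  by_cases hcS : c ∈ S
  · exact ⟨{c}, by simpa using hcS, countable_singleton c, subset_closure rfl⟩
  by_contra! hN
  have hne : ∀ x ∈ S, x ∈ ({c}ᶜ : Set X) := fun x hx hxc => hcS (hxc ▸ hx)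
  let P : Set (X × Set X) :=
    {p | p.1 ∈ S ∧ IsOpen p.2 ∧ p.1 ∈ p.2 ∧ p.2 ⊆ H p.1 {c}ᶜ}
  let r : X × Set X → X × Set X → Prop := fun p q => p.1 ∉ q.2 ∧ q.1 ∉ p.2
  obtain ⟨A, ⟨hAP, hAr⟩, hmax⟩ :=
    zorn_subset {A : Set (X × Set X) | A ⊆ P ∧ A.Pairwise r} (fun C hC hchain =>
      ⟨⋃₀ C, ⟨sUnion_subset fun A hA => (hC hA).1,
        (pairwise_sUnion hchain.directedOn).2 fun A hA => (hC hA).2⟩,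
        fun A hA => subset_sUnion_of_mem hA⟩)
  obtain ⟨D, hDc, hD⟩ := TopologicalSpace.exists_countable_dense X
  have hd : ∀ p ∈ A, ∃ d ∈ D, d ∈ H p.1 p.2 := fun p hp => by
    obtain ⟨-, ho, hm, -⟩ := hAP hp
    obtain ⟨d, hd, hdD⟩ := hD.inter_open_nonempty _ (hH.isOpen ho hm) ⟨_, hH.mem ho hm⟩
    exact ⟨d, hdD, hd⟩
  have : Nonempty X := ⟨c⟩
  choose! d hdD hdH using hd
  have hinj : InjOn d A := fun p hp q hq hpq => by
    by_contra hne'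
    obtain ⟨-, ho, hm, -⟩ := hAP hp
    obtain ⟨-, ho', hm', -⟩ := hAP hq
    have hpq' : d p ∈ H q.1 q.2 := hpq ▸ hdH q hq
    rcases hH.mem_or_mem ho hm ho' hm' (hdH p hp) hpq' with h | h
    · exact (hAr hp hq hne').1 h
    · exact (hAr hp hq hne').2 h
  have hAc : A.Countable := MapsTo.countable_of_injOn (fun p hp => hdD p hp) hinj hDc
  set N := Prod.fst '' A with hNdef
  have hNS : N ⊆ S := by
    rintro _ ⟨p, hp, rfl⟩
    exact (hAP hp).1
  have hcN : c ∈ (closure N)ᶜ := hN N hNS (hAc.image _)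
  have hNo : IsOpen (closure N)ᶜ := isClosed_closure.isOpen_compl
  obtain ⟨x, hxH, hxS⟩ := mem_closure_iff.1 hc _ (hH.isOpen hNo hcN) (hH.mem hNo hcN)
  have hxN : x ∉ closure N := hH.subset hNo hcN hxH
  have hxc := hne x hxS
  have hco : IsOpen ({c}ᶜ : Set X) := isOpen_compl_singleton
  let q : X × Set X := (x, H x {c}ᶜ ∩ (closure N)ᶜ)
  have hq : q ∈ A := by
    refine hmax (y := insert q A) ⟨insert_subset ?_ hAP, ?_⟩ (subset_insert _ _) (mem_insert _ _)
    · exact ⟨hxS, (hH.isOpen hco hxc).inter hNo, ⟨hH.mem hco hxc, hxN⟩, inter_subset_left⟩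
    · refine hAr.insert fun p hp _ => ?_
      have hpN : p.1 ∈ closure N := subset_closure ⟨p, hp, rfl⟩
      have h₁ : p.1 ∉ q.2 := fun h => h.2 hpN
      have h₂ : x ∉ p.2 := fun h => by
        rcases hH.mem_or_mem hco (hne _ (hAP hp).1) hNo hcN ((hAP hp).2.2.2 h) hxH with h | h
        · exact h hpN
        · exact h rfl
      exact ⟨⟨h₂, h₁⟩, ⟨h₁, h₂⟩⟩
  exact hxN (subset_closure ⟨q, hq, rfl⟩)

/-- In a separable monotonically normal space every singleton is the intersection of countably
many of its neighborhoods. -/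
theorem exists_countable_nhds [T1Space X] [TopologicalSpace.SeparableSpace X]
    (hH : IsMonotoneNormalityOperator H) (c : X) :
    ∃ 𝒪 : Set (Set X), 𝒪.Countable ∧ (∀ O ∈ 𝒪, O ∈ 𝓝 c) ∧ ∀ x ≠ c, ∃ O ∈ 𝒪, x ∉ O := by
  obtain ⟨D, hDc, hD⟩ := TopologicalSpace.exists_countable_dense X
  have hco : IsOpen ({c}ᶜ : Set X) := isOpen_compl_singleton
  let W : X → Set X := fun x => H x {c}ᶜ
  have hWo : ∀ {x}, x ≠ c → IsOpen (W x) := fun hx => hH.isOpen hco hx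
  have hxW : ∀ {x}, x ≠ c → x ∈ W x := fun hx => hH.mem hco hx
  have hnhds : ∀ x ≠ c, H c {x}ᶜ ∈ 𝓝 c := fun x hx =>
    (hH.isOpen isOpen_compl_singleton hx.symm).mem_nhds (hH.mem isOpen_compl_singleton hx.symm)
  have hdisj : ∀ {x z}, x ≠ c → z ∈ H c {x}ᶜ → z ∉ W x := fun {x z} hx hz hzW => by
    rcases hH.mem_or_mem hco hx isOpen_compl_singleton hx.symm hzW hz with h | h
    · exact h rfl
    · exact h rfl
  have hpiece : ∀ d, ∃ 𝒪 : Set (Set X), 𝒪.Countable ∧ (∀ O ∈ 𝒪, O ∈ 𝓝 c) ∧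
      ∀ x ≠ c, d ∈ H x (W x) → ∃ O ∈ 𝒪, x ∉ O := fun d => by
    let S : Set X := {x | x ≠ c ∧ d ∈ H x (W x)}
    by_cases hc : c ∈ closure S
    · obtain ⟨N, hNS, hNc, hcN⟩ := hH.exists_countable_mem_closure hc
      refine ⟨(fun x => (W x)ᶜ) '' N, hNc.image _, ?_, fun x hx hdx => ?_⟩
      · rintro _ ⟨x, hxN, rfl⟩
        exact mem_of_superset (hnhds x (hNS hxN).1) fun z hz => hdisj (hNS hxN).1 hz
      · obtain ⟨y, hy, hyN⟩ := mem_closure_iff_nhds.1 hcN _ (hnhds x hx)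
        refine ⟨_, ⟨y, hyN, rfl⟩, fun h => ?_⟩
        obtain ⟨hyc, hdy⟩ := hNS hyN
        rcases hH.mem_or_mem (hWo hx) (hxW hx) (hWo hyc) (hxW hyc) hdx hdy with h' | h'
        · exact h h'
        · exact hdisj hx hy h'
    · refine ⟨{(closure S)ᶜ}, countable_singleton _, ?_, fun x hx hdx =>
        ⟨_, rfl, fun h => h (subset_closure ⟨hx, hdx⟩)⟩⟩
      rintro _ rfl
      exact isClosed_closure.isOpen_compl.mem_nhds hc
  choose 𝒪 h𝒪c h𝒪n h𝒪 using hpiece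
  refine ⟨⋃ d ∈ D, 𝒪 d, hDc.biUnion fun d _ => h𝒪c d, ?_, fun x hx => ?_⟩
  · simp only [mem_iUnion]
    rintro O ⟨d, -, hO⟩
    exact h𝒪n d O hO
  · obtain ⟨d, hd, hdD⟩ := hD.inter_open_nonempty _ (hH.isOpen (hWo hx) (hxW hx))
      ⟨_, hH.mem (hWo hx) (hxW hx)⟩
    obtain ⟨O, hO, hxO⟩ := h𝒪 d x hx hd
    exact ⟨O, mem_biUnion hdD hO, hxO⟩

/-- A separable monotonically normal compact Hausdorff space is first countable. -/
theorem firstCountableTopology [CompactSpace X] [T2Space X] [TopologicalSpace.SeparableSpace X]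
    (hH : IsMonotoneNormalityOperator H) : FirstCountableTopology X := by
  refine ⟨fun c => ?_⟩
  obtain ⟨𝒪, h𝒪c, h𝒪n, h𝒪⟩ := hH.exists_countable_nhds c
  have hE : ∀ O : 𝒪, ∃ E ∈ 𝓝 c, IsClosed E ∧ E ⊆ O := fun O =>
    exists_mem_nhds_isClosed_subset (h𝒪n O O.2)
  choose E hEn hEc hEO using hE
  have := h𝒪c.to_subtype
  suffices h : 𝓝 c = ⨅ O, 𝓟 (E O) by
    rw [h]
    exact isCountablyGenerated_seq _
  refine le_antisymm (le_iInf fun O => le_principal_iff.2 (hEn O))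
    (le_nhds_of_unique_clusterPt fun x hx => ?_)
  by_contra hxc
  obtain ⟨O, hO, hxO⟩ := h𝒪 x hxc
  have hxE : x ∈ closure (E ⟨O, hO⟩) :=
    mem_closure_iff_clusterPt.2 (hx.mono (iInf_le _ _))
  exact hxO (hEO ⟨O, hO⟩ ((hEc _).closure_eq ▸ hxE))

end IsMonotoneNormalityOperator

/-- A family of triples of points is countably split if countably many continuous real functions
suffice to have, for every triple, one of them nonconstant on the triple. -/
def CountablySplit {X : Type*} [TopologicalSpace X] (𝒯 : Set (Fin 3 → X)) : Prop :=
  ∃ Φ : Set C(X, ℝ), Φ.Countable ∧ ∀ T ∈ 𝒯, ∃ g ∈ Φ, ∃ i j, g (T i) ≠ g (T j)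

namespace CountablySplit

variable {X : Type*} [TopologicalSpace X]

theorem iUnion {ι : Type*} [Countable ι] {𝒯 : ι → Set (Fin 3 → X)}
    (h : ∀ i, CountablySplit (𝒯 i)) : CountablySplit (⋃ i, 𝒯 i) := by
  choose Φ hΦc hΦ using h
  refine ⟨⋃ i, Φ i, countable_iUnion hΦc, fun T hT => ?_⟩
  obtain ⟨i, hi⟩ := mem_iUnion.1 hT
  obtain ⟨g, hg, hgT⟩ := hΦ i T hi
  exact ⟨g, mem_iUnion_of_mem i hg, hgT⟩

theorem of_closure [CompactSpace X] [T2Space X] {𝒯 : Set (Fin 3 → X)}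
    (h : ∀ c, Function.const (Fin 3) c ∉ closure 𝒯) : CountablySplit 𝒯 := by
  let G : C(X, ℝ) → Set (Fin 3 → X) := fun g => {T | ∃ i j, g (T i) ≠ g (T j)}
  have hGo : ∀ g, IsOpen (G g) := fun g => by
    simp only [G, ofPred_exists]
    exact isOpen_iUnion fun i => isOpen_iUnion fun j =>
      isOpen_ne_fun (by fun_prop) (by fun_prop)
  obtain ⟨t, ht⟩ := (isClosed_closure (s := 𝒯)).isCompact.elim_finite_subcover G hGo
    fun T hT => by
      have hT' : ∃ i j, T i ≠ T j := by
        by_contra! hconst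
        refine h (T 0) ?_
        convert hT using 1
        exact funext fun i => hconst 0 i
      obtain ⟨i, j, hij⟩ := hT'
      obtain ⟨g, hg₀, hg₁, -⟩ := exists_continuous_zero_one_of_isClosed
        (isClosed_singleton (x := T i)) (isClosed_singleton (x := T j)) (by simpa using hij)
      refine mem_iUnion.2 ⟨g, i, j, ?_⟩
      simp [hg₀ rfl, hg₁ rfl]
  refine ⟨t, t.countable_toSet, fun T hT => ?_⟩
  obtain ⟨g, hg, hgT⟩ := mem_iUnion₂.1 (ht (subset_closure hT))
  exact ⟨g, hg, hgT⟩

end CountablySplit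

theorem exists_continuousMap_apply_eq_of_injective {X : Type*} [TopologicalSpace X] [NormalSpace X]
    [T1Space X] {T : Fin 3 → X} (hT : Function.Injective T) :
    ∃ g : C(X, ℝ), ∀ i, g (T i) = (i : ℕ) := by
  obtain ⟨f, hf₀, hf₁, -⟩ := exists_continuous_zero_one_of_isClosed
    (s := {T 0}) (t := {T 1, T 2}) isClosed_singleton (Set.toFinite _).isClosed
    (by simp [hT.eq_iff])
  obtain ⟨f', hf'₀, hf'₁, -⟩ := exists_continuous_zero_one_of_isClosed
    (s := {T 0, T 1}) (t := {T 2}) (Set.toFinite _).isClosed isClosed_singleton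
    (by simp [hT.eq_iff])
  refine ⟨f + f', fun i => ?_⟩
  fin_cases i
  · simp [hf₀ (show T 0 ∈ _ by simp), hf'₀ (show T 0 ∈ _ by simp)]
  · simp [hf₁ (show T 1 ∈ _ by simp), hf'₀ (show T 1 ∈ _ by simp)]
  · simp [hf₁ (show T 2 ∈ _ by simp), hf'₁ (show T 2 ∈ _ by simp)]
    norm_num

/-- The triples of distinct points of a separable monotonically normal compact Hausdorff space are
countably split. -/
theorem IsMonotoneNormalityOperator.countablySplit_injective {X : Type*} [TopologicalSpace X]
    [CompactSpace X] [T2Space X] [TopologicalSpace.SeparableSpace X] {H : X → Set X → Set X}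
    (hH : IsMonotoneNormalityOperator H) :
    CountablySplit {T : Fin 3 → X | Function.Injective T} := by
  have := hH.firstCountableTopology
  obtain ⟨D, hDc, hD⟩ := TopologicalSpace.exists_countable_dense X
  have := hDc.to_subtype
  choose! g hg using fun (T : Fin 3 → X) (hT : Function.Injective T) =>
    exists_continuousMap_apply_eq_of_injective hT
  let U : (Fin 3 → X) → Fin 3 → Set X := fun T i => {x | |g T x - (i : ℕ)| < 1 / 2}
  have hUo : ∀ T i, IsOpen (U T i) := fun T i => isOpen_lt (by fun_prop) continuous_const
  have hTU : ∀ {T}, Function.Injective T → ∀ i, T i ∈ U T i := fun hT i => by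
    simp [U, hg _ hT]
  have hUne : ∀ {T i j x y}, x ∈ U T i → y ∈ U T j → i ≠ j → g T x ≠ g T y := by
    intro T i j x y hx hy hij hxy
    simp only [U, mem_ofPred_eq, abs_lt] at hx hy
    rw [hxy] at hx
    have h₁ : ((i : ℕ) : ℝ) < (j : ℕ) + 1 := by linarith
    have h₂ : ((j : ℕ) : ℝ) < (i : ℕ) + 1 := by linarith
    norm_cast at h₁ h₂
    exact hij (Fin.ext (by omega))
  let W : (Fin 3 → X) → Fin 3 → Set X := fun T i => H (T i) (U T i)
  have hWo : ∀ {T}, Function.Injective T → ∀ i, IsOpen (W T i) := fun hT i =>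
    hH.isOpen (hUo _ i) (hTU hT i)
  have hTW : ∀ {T}, Function.Injective T → ∀ i, T i ∈ W T i := fun hT i =>
    hH.mem (hUo _ i) (hTU hT i)
  let 𝒯 : (Fin 3 → D) → Set (Fin 3 → X) := fun δ =>
    {T | Function.Injective T ∧ ∀ i, (δ i : X) ∈ H (T i) (W T i)}
  have hcover : {T : Fin 3 → X | Function.Injective T} = ⋃ δ, 𝒯 δ := by
    refine Subset.antisymm (fun T hT => ?_) (iUnion_subset fun δ T hT => hT.1)
    have hδ : ∀ i, ∃ d : D, (d : X) ∈ H (T i) (W T i) := fun i => by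
      obtain ⟨d, hd, hdD⟩ := hD.inter_open_nonempty _ (hH.isOpen (hWo hT i) (hTW hT i))
        ⟨_, hH.mem (hWo hT i) (hTW hT i)⟩
      exact ⟨⟨d, hdD⟩, hd⟩
    choose δ hδ using hδ
    exact mem_iUnion.2 ⟨δ, hT, hδ⟩
  rw [hcover]
  refine CountablySplit.iUnion fun δ => ?_
  by_cases hc : ∀ c, Function.const (Fin 3) c ∉ closure (𝒯 δ)
  · exact CountablySplit.of_closure hc
  push Not at hc
  obtain ⟨c, hc⟩ := hc
  obtain ⟨u, hu, hlim⟩ := mem_closure_iff_seq_limit.1 hc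
  refine ⟨range fun n => g (u n), countable_range _, fun T ⟨hT, hTδ⟩ => ?_⟩
  let O : Set X := (range T \ {c})ᶜ
  have hOo : IsOpen O := (finite_range T).sdiff.isClosed.isOpen_compl
  have hcO : c ∈ O := fun h => h.2 rfl
  obtain ⟨n, hn⟩ : ∃ n, ∀ i, u n i ∈ H c O := by
    have : ∀ᶠ n in atTop, ∀ i, u n i ∈ H c O := eventually_all.2 fun i =>
      (tendsto_pi_nhds.1 hlim i).eventually
        ((hH.isOpen hOo hcO).mem_nhds (hH.mem hOo hcO))
    exact this.exists
  obtain ⟨hun, hunδ⟩ := hu n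
  have key : ∀ i, T i ∈ U (u n) i ∨ c ∈ U T i := fun i => by
    rcases hH.mem_or_mem (hWo hT i) (hTW hT i) (hWo hun i) (hTW hun i) (hTδ i) (hunδ i)
      with h | h
    · exact Or.inl (hH.subset (hUo _ i) (hTU hun i) h)
    · refine Or.inr ?_
      rcases hH.mem_or_mem (hUo T i) (hTU hT i) hOo hcO h (hn i) with h' | h'
      · have hTc : T i = c := by
          by_contra hne
          exact h' ⟨mem_range_self i, hne⟩
        exact hTc ▸ hTU hT i
      · exact h'
  have hcU : ∀ {i j}, i ≠ j → c ∈ U T i → c ∉ U T j := fun hij hi hj => hUne hi hj hij rfl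
  obtain ⟨i, j, hij, hi, hj⟩ : ∃ i j, i ≠ j ∧ T i ∈ U (u n) i ∧ T j ∈ U (u n) j := by
    by_cases h₀ : c ∈ U T 0
    · exact ⟨1, 2, by decide, (key 1).resolve_right (hcU (by decide) h₀),
        (key 2).resolve_right (hcU (by decide) h₀)⟩
    by_cases h₁ : c ∈ U T 1
    · exact ⟨0, 2, by decide, (key 0).resolve_right h₀,
        (key 2).resolve_right (hcU (by decide) h₁)⟩
    exact ⟨0, 1, by decide, (key 0).resolve_right h₀, (key 1).resolve_right h₁⟩
  exact ⟨g (u n), mem_range_self n, i, j, hUne hi hj hij⟩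

/-- Every separable monotonically normal compact Hausdorff space maps continuously onto a
separable metric space with fibers of cardinality at most 2. -/
theorem separable_monotonicallyNormal_compactum_two_to_one_map
    (X : Type*) [TopologicalSpace X] [CompactSpace X] [T2Space X] [T1Space X]
    [TopologicalSpace.SeparableSpace X] (hmn : MonotonicallyNormal X) :
    ∃ (M : Type) (_ : MetricSpace M) (f : X → M),
      TopologicalSpace.SeparableSpace M ∧ Continuous f ∧ Function.Surjective f ∧
      ∀ m : M, Cardinal.mk (f ⁻¹' {m}) ≤ 2 := by
  obtain ⟨H, hH⟩ := hmn.exists_operator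
  obtain ⟨Φ, hΦc, hΦ⟩ := hH.countablySplit_injective
  obtain ⟨φ, hφ⟩ := (hΦc.insert 0).exists_eq_range (insert_nonempty _ _)
  let F : X → ℕ → ℝ := fun x n => φ n x
  have hF : Continuous F := by fun_prop
  refine ⟨range F, TopologicalSpace.metrizableSpaceMetric (range F), rangeFactorization F,
    inferInstance, hF.rangeFactorization, rangeFactorization_surjective, fun m => ?_⟩
  by_contra! hcard
  have h3 : ((2 : ℕ) : Cardinal) + 1 ≤ Cardinal.mk (rangeFactorization F ⁻¹' {m}) :=
    Cardinal.natCast_add_one_le_iff.2 (by exact_mod_cast hcard)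
  obtain ⟨e⟩ : Nonempty (Fin 3 ↪ rangeFactorization F ⁻¹' {m}) := by
    rw [← Cardinal.lift_mk_le', Cardinal.lift_mk_fin, Cardinal.lift_uzero]
    exact_mod_cast h3
  obtain ⟨g, hg, i, j, hij⟩ := hΦ (fun k => (e k : X))
    (Subtype.val_injective.comp e.injective)
  obtain ⟨n, rfl⟩ : g ∈ range φ := hφ ▸ mem_insert_of_mem _ hg
  have hval : ∀ k, F (e k) = m := fun k => congrArg Subtype.val (e k).2
  exact hij (congrFun ((hval i).trans (hval j).symm) n)
end

section
/- Assuming the Continuum Hypothesis, there exists a compact, first countable, connected Hausdorff space of weight ℵ₁ which has no totally disconnected perfect subsets. -/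
open Cardinal

/-- The weight of a topological space: the minimal cardinality of a base. -/
noncomputable def weightOf (X : Type) [TopologicalSpace X] : Cardinal :=
  sInf {c : Cardinal | ∃ B : Set (Set X), TopologicalSpace.IsTopologicalBasis B ∧ #B = c}

open Set Topology unitInterval

set_option linter.unusedSectionVars false

section WellOrder

variable {Ω : Type} [LinearOrder Ω] [WellFoundedLT Ω]

theorem exists_forall_of_forall_exists_below {D : Type} [Nonempty D]
    (R : Ω → (Ω → D) → D → Prop)
    (hR : ∀ β d d' v, (∀ ε < β, d ε = d' ε) → R β d v → R β d' v)
    (hex : ∀ β d, ∃ v, R β d v) : ∃ d : Ω → D, ∀ β, R β d (d β) := by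
  classical
  choose v hv using hex
  obtain ⟨d₀⟩ := ‹Nonempty D›
  let d : Ω → D := WellFoundedLT.fix (motive := fun _ => D)
    (fun β prev => v β (fun ε => if h : ε < β then prev ε h else d₀))
  refine ⟨d, fun β => ?_⟩
  have h : d β = v β (fun ε => if ε < β then d ε else d₀) := by
    have := WellFoundedLT.fix_eq (motive := fun _ => D)
      (fun (β : Ω) prev => v β (fun ε => if h : ε < β then prev ε h else d₀)) β
    simpa [d] using this
  rw [h]
  refine hR β _ _ _ ?_ (hv _ _)
  intro ε hε
  simp [hε]

theorem exists_isLUB_of_bddAbove {s : Set Ω} (hb : BddAbove s) : ∃ a, IsLUB s a := by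
  have hne : (upperBounds s).Nonempty := hb
  exact ⟨WellFounded.min wellFounded_lt _ hne, WellFounded.min_mem _ _ hne,
    fun b hb => not_lt.1 (WellFounded.not_lt_min _ _ hb)⟩

variable [∀ a : Ω, Countable (Iio a)] [Uncountable Ω]

theorem exists_gt_of_countable {s : Set Ω} (hs : s.Countable) : ∃ b, ∀ a ∈ s, a < b := by
  have h : (⋃ a ∈ s, Iic a).Countable := by
    refine hs.biUnion fun a _ => ?_
    rw [← Iio_insert]
    exact (Set.to_countable (Iio a)).insert a
  by_contra! hcon
  refine not_countable (α := Ω) (countable_univ_iff.1 (h.mono fun b _ => ?_))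
  obtain ⟨a, ha, hab⟩ := hcon b
  simpa using ⟨a, ha, hab⟩

theorem exists_le_mem_of_not_countable {s : Set Ω} (hs : ¬ s.Countable) (a : Ω) :
    ∃ b ∈ s, a ≤ b := by
  by_contra! hcon
  exact hs ((Set.to_countable (Iio a)).mono hcon)

/-- Closed and unbounded subsets of a well order. -/
structure IsClubSet (D : Set Ω) : Prop where
  unbounded : ∀ a, ∃ b ∈ D, a < b
  closed : ∀ s ⊆ D, s.Nonempty → ∀ a, IsLUB s a → a ∈ D

theorem IsClubSet.iInter {ι : Type} [Countable ι] {D : ι → Set Ω}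
    (hD : ∀ i, IsClubSet (D i)) : IsClubSet (⋂ i, D i) := by
  refine ⟨fun a => ?_, fun s hs hne b hb => mem_iInter.2 fun i =>
    (hD i).closed s (hs.trans (iInter_subset _ i)) hne b hb⟩
  have hstep : ∀ b : Ω, ∃ c, b < c ∧ ∀ i, ∃ x ∈ D i, b < x ∧ x < c := by
    intro b
    choose f hfD hf using fun i => (hD i).unbounded b
    obtain ⟨c, hc⟩ := exists_gt_of_countable ((countable_range f).insert b)
    exact ⟨c, hc b (mem_insert _ _), fun i => ⟨f i, hfD i, hf i, hc _ (Or.inr ⟨i, rfl⟩)⟩⟩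
  choose nxt hnxt hbetween using hstep
  choose x hxD hbx hxn using hbetween
  let u : ℕ → Ω := fun n => nxt^[n] a
  have hu : ∀ n, u (n + 1) = nxt (u n) := fun n => Function.iterate_succ_apply' _ _ _
  obtain ⟨B, hB⟩ := exists_gt_of_countable (countable_range u)
  obtain ⟨l, hl⟩ := exists_isLUB_of_bddAbove (s := range u) ⟨B, fun y hy => (hB y hy).le⟩
  have hlt : ∀ n, u n < l := fun n =>
    (hnxt (u n)).trans_le (hu n ▸ hl.1 ⟨n + 1, rfl⟩)
  refine ⟨l, mem_iInter.2 fun i => ?_, hlt 0⟩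
  refine (hD i).closed (range fun n => x (u n) i) ?_ ⟨_, 0, rfl⟩ l ⟨?_, ?_⟩
  · rintro _ ⟨n, rfl⟩
    exact hxD _ _
  · rintro _ ⟨n, rfl⟩
    exact (hxn _ _).le.trans (hu n ▸ hl.1 ⟨n + 1, rfl⟩)
  · intro b hb
    refine hl.2 ?_
    rintro _ ⟨n, rfl⟩
    exact (hbx (u n) i).le.trans (hb ⟨n, rfl⟩)

theorem IsClubSet.inter {D E : Set Ω} (hD : IsClubSet D) (hE : IsClubSet E) :
    IsClubSet (D ∩ E) := by
  rw [inter_eq_iInter]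
  exact IsClubSet.iInter fun b => by cases b <;> assumption

theorem isClubSet_univ : IsClubSet (univ : Set Ω) := by
  refine ⟨fun a => ?_, fun _ _ _ _ _ => trivial⟩
  obtain ⟨b, hb⟩ := exists_gt_of_countable (countable_singleton a)
  exact ⟨b, trivial, hb a rfl⟩

/-- Codes for the initial segments of a sequence of functions on a well order. -/
abbrev SegmentCode (Ω : Type) [LinearOrder Ω] : Type := Σ δ : Ω, (Iio δ → ℕ → I)

/-- The code of the initial segments of length `δ`. -/
def segmentCode (δ : Ω) (w : ℕ → Ω → I) : SegmentCode Ω := ⟨δ, fun ξ m => w m ξ⟩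

theorem segmentCode_inj {δ δ' : Ω} {w w' : ℕ → Ω → I}
    (h : segmentCode δ w = segmentCode δ' w') :
    δ = δ' ∧ ∀ m, EqOn (w m) (w' m) (Iio δ) := by
  unfold segmentCode at h
  rw [Sigma.mk.inj_iff] at h
  obtain ⟨rfl, h⟩ := h
  exact ⟨rfl, fun m ξ hξ => congr_fun (congr_fun (eq_of_heq h) ⟨ξ, hξ⟩) m⟩

/-- A form of the weak diamond principle of Devlin and Shelah. -/
theorem exists_not_guessed_on_club
    (hcard : #(SegmentCode Ω) < #(Ω → I))
    (F : Ω → (Ω → I) → SegmentCode Ω)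
    (hF : ∀ γ z z', EqOn z z' (Iio γ) → F γ z = F γ z') :
    ∃ g : Ω → SegmentCode Ω, ∀ (z : Ω → I) (D : Set Ω), IsClubSet D →
      ∃ γ ∈ D, F γ z ≠ g γ := by
  by_contra! hcon
  choose Z D hD hZ using hcon
  have hnx : ∀ (E : Set Ω) (α : Ω), ∃ δ, IsClubSet E →
      δ ∈ E ∧ α < δ ∧ ∀ x ∈ E, α < x → δ ≤ x := by
    intro E α
    by_cases hE : IsClubSet E
    · have hne : (E ∩ Ioi α).Nonempty := (hE.unbounded α).imp fun b hb => hb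
      have hm := WellFounded.min_mem (wellFounded_lt (α := Ω)) _ hne
      exact ⟨_, fun _ => ⟨hm.1, hm.2, fun x hx hax =>
        not_lt.1 (WellFounded.not_lt_min _ _ (show x ∈ E ∩ Ioi α from ⟨hx, hax⟩))⟩⟩
    · exact ⟨α, fun h => absurd h hE⟩
  choose nx hnx using hnx
  let G : (ℕ → Ω → I) × Set Ω → Ω → SegmentCode Ω := fun s α => segmentCode (nx s.2 α) s.1
  let next : (ℕ → Ω → I) × Set Ω → (ℕ → Ω → I) × Set Ω := fun s =>
    (fun m => Nat.casesOn m (Z (G s)) s.1, s.2 ∩ D (G s))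
  let st : (Ω → I) → ℕ → (ℕ → Ω → I) × Set Ω := fun h n => next^[n] (fun _ => h, univ)
  have hst : ∀ h n, st h (n + 1) = next (st h n) := fun h n =>
    Function.iterate_succ_apply' _ _ _
  have hclub : ∀ h n, IsClubSet (st h n).2 := by
    intro h n
    induction n with
    | zero => exact isClubSet_univ
    | succ n ih =>
      rw [hst]
      exact ih.inter (hD _)
  have hanti : ∀ h m n, m ≤ n → (st h n).2 ⊆ (st h m).2 := by
    intro h m n hmn
    induction n, hmn using Nat.le_induction with
    | base => exact subset_rfl
    | succ n _ ih =>
      rw [hst]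
      exact inter_subset_left.trans ih
  have hshift : ∀ h n k j, (st h (n + k)).1 (j + k) = (st h n).1 j := by
    intro h n k
    induction k with
    | zero => intro j; rfl
    | succ k ih =>
      intro j
      rw [← ih j, ← add_assoc, hst]
      rfl
  have hinter : ∀ h, IsClubSet (⋂ n, (st h n).2) := fun h => IsClubSet.iInter (hclub h)
  have hstart : ∀ h, ∃ α, α ∈ ⋂ n, (st h n).2 := by
    intro h
    have : Nonempty Ω := inferInstance
    obtain ⟨a⟩ := this
    obtain ⟨b, hb, -⟩ := (hinter h).unbounded a
    exact ⟨b, hb⟩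
  choose α₀ hα₀ using hstart
  let code : (Ω → I) → SegmentCode Ω := fun h =>
    segmentCode (α₀ h) (fun k => (st h k.unpair.1).1 k.unpair.2)
  have hninj : ¬ Function.Injective code := fun hinj =>
    (Cardinal.mk_le_of_injective hinj).not_gt hcard
  simp only [Function.Injective, not_forall] at hninj
  obtain ⟨h, h', hcode, hne⟩ := hninj
  obtain ⟨hα, hagree⟩ := segmentCode_inj hcode
  let E : Set Ω := {α | (∀ n, α ∈ (st h n).2) ∧ (∀ n, α ∈ (st h' n).2) ∧
    ∀ n m, EqOn ((st h n).1 m) ((st h' n).1 m) (Iio α)}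
  have hE₀ : α₀ h ∈ E := by
    refine ⟨mem_iInter.1 (hα₀ h), hα ▸ mem_iInter.1 (hα₀ h'), fun n m => ?_⟩
    simpa using hagree (Nat.pair n m)
  have hEstep : ∀ α ∈ E, ∃ β ∈ E, α < β := by
    rintro α ⟨hα1, hα2, hα3⟩
    have hmem : ∀ f : Ω → I, (∀ n, α ∈ (st f n).2) → ∀ n,
        F α ((st f (n + 1)).1 0) = segmentCode (nx (st f n).2 α) (st f n).1 := by
      intro f hf n
      have h1 := hf (n + 1)
      rw [hst] at h1 ⊢
      exact hZ _ α h1.2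
    have hkey : ∀ n, nx (st h n).2 α = nx (st h' n).2 α ∧
        ∀ m, EqOn ((st h n).1 m) ((st h' n).1 m) (Iio (nx (st h n).2 α)) := by
      intro n
      apply segmentCode_inj
      rw [← hmem h hα1, ← hmem h' hα2]
      exact hF _ _ _ (hα3 _ _)
    let δ : ℕ → Ω := fun n => nx (st h n).2 α
    have hδ : ∀ n, δ n ∈ (st h n).2 ∧ α < δ n ∧ ∀ x ∈ (st h n).2, α < x → δ n ≤ x :=
      fun n => hnx _ α (hclub h n)
    have hδ' : ∀ n, δ n ∈ (st h' n).2 := fun n => by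
      simp only [δ, (hkey n).1]
      exact (hnx _ α (hclub h' n)).1
    have hmono : ∀ m n, m ≤ n → δ m ≤ δ n := fun m n hmn =>
      (hδ m).2.2 _ (hanti h m n hmn (hδ n).1) (hδ n).2.1
    obtain ⟨B, hB⟩ := exists_gt_of_countable (countable_range δ)
    obtain ⟨l, hl⟩ := exists_isLUB_of_bddAbove (s := range δ) ⟨B, fun y hy => (hB y hy).le⟩
    have htail : ∀ n, IsLUB (range fun k => δ (n + k)) l := by
      refine fun n => ⟨?_, fun b hb => hl.2 ?_⟩
      · rintro _ ⟨k, rfl⟩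
        exact hl.1 ⟨_, rfl⟩
      · rintro _ ⟨k, rfl⟩
        exact (hmono k (n + k) (by omega)).trans (hb (mem_range_self k))
    refine ⟨l, ⟨fun n => ?_, fun n => ?_, fun n m ξ hξ => ?_⟩, (hδ 0).2.1.trans_le (hl.1 ⟨0, rfl⟩)⟩
    · refine (hclub h n).closed _ ?_ (range_nonempty _) l (htail n)
      rintro _ ⟨k, rfl⟩
      exact hanti h n (n + k) (by lia) (hδ _).1
    · refine (hclub h' n).closed _ ?_ (range_nonempty _) l (htail n)
      rintro _ ⟨k, rfl⟩
      exact hanti h' n (n + k) (by omega) (hδ' _)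
    · obtain ⟨_, ⟨k, rfl⟩, hk⟩ := (lt_isLUB_iff (htail n)).1 hξ
      rw [← hshift h n k, ← hshift h' n k]
      exact (hkey (n + k)).2 _ hk
  have hEclosed : ∀ a, IsLUB E a → a ∈ E := by
    intro a ha
    refine ⟨fun n => (hclub h n).closed E (fun x hx => hx.1 n) ⟨_, hE₀⟩ a ha,
      fun n => (hclub h' n).closed E (fun x hx => hx.2.1 n) ⟨_, hE₀⟩ a ha, fun n m ξ hξ => ?_⟩
    obtain ⟨b, hb, hξb⟩ := (lt_isLUB_iff ha).1 hξ
    exact hb.2.2 n m hξb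
  have hunb : ¬ BddAbove E := by
    intro hb
    obtain ⟨a, ha⟩ := exists_isLUB_of_bddAbove hb
    obtain ⟨b, hbE, hab⟩ := hEstep a (hEclosed a ha)
    exact (ha.1 hbE).not_gt hab
  apply hne
  funext ξ
  rw [not_bddAbove_iff] at hunb
  obtain ⟨b, hb, hξb⟩ := hunb ξ
  exact hb.2.2 0 0 hξb

end WellOrder

section Coloring

variable {Ω : Type} [LinearOrder Ω] [WellFoundedLT Ω] [∀ a : Ω, Countable (Iio a)] [Uncountable Ω]

theorem exists_surjective_of_mk_le {S T : Type} [Nonempty T] (h : #T ≤ #S) :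
    ∃ τ : S → T, Function.Surjective τ := by
  obtain ⟨e⟩ := h
  exact ⟨Function.invFun e, Function.invFun_surjective e.injective⟩

/-- A coloring in which every color occurs uncountably often in each of the given sets. -/
theorem exists_coloring {Y C Q : Type} [Nonempty C] (hC : #C ≤ #Ω) (hQ : #Q ≤ #Ω)
    (K : Q → Set Y) :
    ∃ F : Y → C, ∀ q, ¬ (K q).Countable → ∀ c, ¬ {y ∈ K q | F y = c}.Countable := by
  classical
  let Q' := {q // ¬ (K q).Countable}
  rcases isEmpty_or_nonempty Q' with hQ' | hQ'
  · exact ⟨fun _ => Classical.arbitrary C, fun q hq => (hQ'.false ⟨q, hq⟩).elim⟩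
  have hinf : ℵ₀ ≤ #Ω := Cardinal.infinite_iff.1 inferInstance
  have hcard : #(Q' × C × Ω) ≤ #Ω := by
    rw [Cardinal.mk_prod, Cardinal.mk_prod]
    simp only [Cardinal.lift_id]
    exact Cardinal.mul_le_of_le hinf ((Cardinal.mk_subtype_le _).trans hQ)
      (Cardinal.mul_le_of_le hinf hC le_rfl)
  obtain ⟨τ, hτ⟩ := exists_surjective_of_mk_le hcard
  obtain ⟨q₀⟩ := hQ'
  have hY : Nonempty Y := by
    by_contra hY
    rw [not_nonempty_iff] at hY
    exact q₀.2 (to_countable _)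
  obtain ⟨f, hf⟩ := exists_forall_of_forall_exists_below (Ω := Ω) (D := Y)
    (fun β d v => v ∈ K (τ β).1 ∧ ∀ ε < β, d ε ≠ v)
    (fun β d d' v h hv => ⟨hv.1, fun ε hε => h ε hε ▸ hv.2 ε hε⟩)
    (fun β d => by
      by_contra! hcon
      refine (τ β).1.2 (((to_countable (Iio β)).image d).mono fun v hv => ?_)
      obtain ⟨ε, hε, h⟩ := hcon v hv
      exact ⟨ε, hε, h⟩)
  have hinj : Function.Injective f := by
    intro a b hab
    rcases lt_trichotomy a b with h | h | h
    · exact absurd hab ((hf b).2 a h)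
    · exact h
    · exact absurd hab.symm ((hf a).2 b h)
  refine ⟨fun y => (τ (Function.invFun f y)).2.1, fun q hq c hcount => ?_⟩
  have hleft := Function.leftInverse_invFun hinj
  have hsub : (f ⁻¹' {y ∈ K q | (τ (Function.invFun f y)).2.1 = c}).Countable :=
    hcount.preimage hinj
  refine not_countable (α := Ω) (countable_univ_iff.1 ((hsub.image fun ω => (τ ω).2.2).mono ?_))
  intro ξ _
  obtain ⟨ω, hω⟩ := hτ (⟨q, hq⟩, c, ξ)
  refine ⟨ω, ⟨?_, ?_⟩, by simp [hω]⟩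
  · simpa [hω] using (hf ω).1
  · simp [hleft ω, hω]

end Coloring

section Oscillation

/-- A function that is continuous except at `y`, where it oscillates along each of countably many
sets. -/
theorem exists_oscillating {Y ι : Type} [TopologicalSpace Y] [TopologicalSpace.MetrizableSpace Y]
    [Countable ι] (y : Y) (L : ι → Set Y) (hL : ∀ i, y ∈ closure (L i \ {y})) :
    ∃ φ : Y → I, (∀ z ≠ y, ContinuousAt φ z) ∧
      ∀ i s, (y, s) ∈ closure ((fun z => (z, φ z)) '' (L i \ {y})) := by
  let _ := TopologicalSpace.metrizableSpaceMetric Y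
  rcases isEmpty_or_nonempty ι with hι | hι
  · exact ⟨fun _ => 0, fun z _ => continuousAt_const, fun i => (hι.false i).elim⟩
  obtain ⟨e, he⟩ := exists_surjective_nat (ι × ℕ × ℕ)
  let u : Y → ℝ := fun z => (dist z y)⁻¹
  have hpick : ∀ i (B : ℝ), ∃ z ∈ L i \ {y}, B ≤ u z := by
    intro i B
    obtain ⟨z, hz, hd⟩ := Metric.mem_closure_iff.1 (hL i) (max B 1)⁻¹ (by positivity)
    refine ⟨z, hz, (le_max_left B 1).trans ?_⟩
    have hpos : 0 < dist z y := dist_pos.2 hz.2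
    rw [dist_comm] at hd
    exact (le_inv_comm₀ hpos (by positivity)).1 hd.le
  choose pick hpickL hpicku using hpick
  let z : ℕ → Y := fun n =>
    Nat.rec (pick (e 0).1 0) (fun k p => pick (e (k + 1)).1 (u p + 1)) n
  have hzL : ∀ n, z n ∈ L (e n).1 \ {y} := by
    intro n
    cases n <;> exact hpickL _ _
  have hz0 : 0 ≤ u (z 0) := hpicku _ _
  have hzu : ∀ n, u (z n) + 1 ≤ u (z (n + 1)) := fun n => hpicku _ _
  have hgrow : ∀ m k : ℕ, u (z m) + k ≤ u (z (m + k)) := by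
    intro m k
    induction k with
    | zero => simp
    | succ k ih =>
      have := hzu (m + k)
      push_cast
      rw [← add_assoc m k 1]
      linarith
  have hlt : ∀ m n, m < n → 1 ≤ dist (u (z m)) (u (z n)) := by
    intro m n hmn
    obtain ⟨k, rfl⟩ := Nat.exists_eq_add_of_lt hmn
    have h1 := hgrow m (k + 1)
    have h2 : (0 : ℝ) ≤ k := Nat.cast_nonneg k
    rw [dist_comm, Real.dist_eq, ← add_assoc] at *
    push_cast at h1
    exact le_trans (by linarith) (le_abs_self _)
  have hemb : IsClosedEmbedding fun n => u (z n) := by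
    refine Metric.isClosedEmbedding_of_pairwise_le_dist one_pos fun m n hmn => ?_
    rcases lt_or_gt_of_ne hmn with h | h
    · exact hlt m n h
    · rw [dist_comm]
      exact hlt n m h
  let s : ℕ → I := fun n => TopologicalSpace.denseSeq I (e n).2.1
  obtain ⟨ψ, hψ⟩ := ContinuousMap.exists_extension hemb ⟨s, continuous_of_discreteTopology⟩
  have hψs : ∀ n, ψ (u (z n)) = s n := fun n => DFunLike.congr_fun hψ n
  refine ⟨fun z => ψ (u z), fun w hw => ?_, fun i t => ?_⟩
  · refine ψ.continuous.continuousAt.comp ?_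
    exact ContinuousAt.inv₀ (by fun_prop) (dist_ne_zero.2 hw)
  · rw [mem_closure_iff_nhds]
    intro V hV
    rw [nhds_prod_eq, Filter.mem_prod_iff] at hV
    obtain ⟨U, hU, W, hW, hUW⟩ := hV
    obtain ⟨ε, hε, hεU⟩ := Metric.mem_nhds_iff.1 hU
    obtain ⟨W', hW'W, hW'o, htW'⟩ := mem_nhds_iff.1 hW
    obtain ⟨j, hj⟩ := (TopologicalSpace.denseRange_denseSeq I).exists_mem_open hW'o ⟨t, htW'⟩
    have hinf : {n | (e n).1 = i ∧ (e n).2.1 = j}.Infinite := by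
      have : (range fun k : ℕ => (i, j, k)).Infinite :=
        infinite_range_of_injective fun a b h => by simpa using h
      refine Infinite.of_image e (this.mono ?_)
      rintro _ ⟨k, rfl⟩
      obtain ⟨n, hn⟩ := he (i, j, k)
      exact ⟨n, by simp [hn], hn⟩
    obtain ⟨N, hN⟩ := exists_nat_gt ε⁻¹
    obtain ⟨n, ⟨hni, hnj⟩, hNn⟩ := hinf.exists_gt N
    have hnu : ε⁻¹ < u (z n) := by
      have h1 := hgrow 0 n
      rw [zero_add] at h1
      have h2 : (N : ℝ) < n := by exact_mod_cast hNn
      linarith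
    have hd : dist (z n) y < ε := by
      have hpos : 0 < dist (z n) y := dist_pos.2 (hzL n).2
      exact (inv_lt_inv₀ hε hpos).1 hnu
    refine ⟨(z n, ψ (u (z n))), hUW ⟨hεU hd, hW'W ?_⟩, z n, hni ▸ hzL n, rfl⟩
    simpa only [hψs, s, hnj] using hj

end Oscillation

section System

variable {Ω : Type} [LinearOrder Ω] [WellFoundedLT Ω]

/-- The data determining one coordinate of the inverse system: unless `on` holds and a point agrees
with `pt` below `lvl`, the coordinate is given by `fn`. -/
structure Datum (Ω : Type) where
  on : Prop
  lvl : Ω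
  pt : Ω → I
  fn : (Ω → I) → I

/-- The point `x` is split by the datum. -/
def Datum.Splits (D : Datum Ω) (x : Ω → I) : Prop := D.on ∧ EqOn x D.pt (Iio D.lvl)

/-- The datum can be used at coordinate `β`. -/
structure Datum.IsValid (D : Datum Ω) (β : Ω) : Prop where
  lvl_le : D.lvl ≤ β
  congr : ∀ x z, EqOn x z (Iio D.lvl) → D.fn x = D.fn z
  continuousAt : ∀ x, ¬ D.Splits x → ContinuousAt D.fn x

/-- The restriction of a point to the coordinates below `γ`. -/
def cut (γ : Ω) (x : Ω → I) : Iio γ → I := fun ξ => x ξ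

/-- The function of the datum oscillates along `M` near its split point. -/
def Datum.Oscillates (D : Datum Ω) (M : Set (Ω → I)) : Prop :=
  ∀ s : I, (cut D.lvl D.pt, s) ∈
    closure ((fun z => (cut D.lvl z, D.fn z)) '' {z ∈ M | ¬ D.Splits z})

/-- The limit space of a system of data. -/
def systemSpace (d : Ω → Datum Ω) : Set (Ω → I) :=
  {x | ∀ β, (d β).Splits x ∨ x β = (d β).fn x}

theorem continuous_cut (γ : Ω) : Continuous (cut γ : (Ω → I) → Iio γ → I) :=
  continuous_pi fun ξ => continuous_apply (ξ : Ω)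

theorem cut_eq_cut_iff {γ : Ω} {x x' : Ω → I} : cut γ x = cut γ x' ↔ EqOn x x' (Iio γ) :=
  ⟨fun h ξ hξ => congr_fun h ⟨ξ, hξ⟩, fun h => funext fun ξ => h ξ.2⟩

theorem Datum.splits_congr {D : Datum Ω} {x x' : Ω → I} (h : EqOn x x' (Iio D.lvl)) :
    D.Splits x ↔ D.Splits x' :=
  and_congr_right fun _ => ⟨fun hx => h.symm.trans hx, fun hx => h.trans hx⟩

theorem isClosed_setOf_eqOn {Z : Type} [TopologicalSpace Z] {u v : Z → Ω → I}
    (hu : Continuous u) (hv : Continuous v) (S : Set Ω) : IsClosed {w | EqOn (u w) (v w) S} := by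
  simp only [EqOn, ofPred_forall]
  exact isClosed_iInter fun ξ => isClosed_iInter fun _ =>
    isClosed_eq ((continuous_apply ξ).comp hu) ((continuous_apply ξ).comp hv)

theorem Datum.Oscillates.mono {D : Datum Ω} {β : Ω} (hD : D.IsValid β) {M M' : Set (Ω → I)}
    (h : D.Oscillates M) (hM : ∀ z ∈ M, ∃ z' ∈ M', EqOn z z' (Iio D.lvl)) : D.Oscillates M' := by
  refine fun s => closure_mono ?_ (h s)
  rintro _ ⟨z, ⟨hz, hzs⟩, rfl⟩
  obtain ⟨z', hz', he⟩ := hM z hz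
  exact ⟨z', ⟨hz', fun hs => hzs ((D.splits_congr he).2 hs)⟩,
    Prod.ext (cut_eq_cut_iff.2 he.symm) (hD.congr _ _ he.symm)⟩

variable {d : Ω → Datum Ω}

theorem isClosed_systemSpace (hd : ∀ β, (d β).IsValid β) : IsClosed (systemSpace d) := by
  simp only [systemSpace, ofPred_forall]
  refine isClosed_iInter fun β => isOpen_compl_iff.1 (isOpen_iff_mem_nhds.2 fun x hx => ?_)
  simp only [mem_compl_iff, mem_ofPred_eq, not_or] at hx
  have h1 : ∀ᶠ z in 𝓝 x, ¬ (d β).Splits z := by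
    by_cases hon : (d β).on
    · have hc := isClosed_setOf_eqOn (Ω := Ω) continuous_id
        (continuous_const (y := (d β).pt)) (Iio (d β).lvl)
      filter_upwards [hc.isOpen_compl.mem_nhds fun h => hx.1 ⟨hon, h⟩] with z hz hs
      exact hz hs.2
    · exact Filter.Eventually.of_forall fun z hz => hon hz.1
  have h2 : ∀ᶠ z in 𝓝 x, z β ≠ (d β).fn z :=
    ((continuous_apply β).continuousAt.ne_iff_eventually_ne ((hd β).continuousAt x hx.1)).1 hx.2
  filter_upwards [h1, h2] with z hz1 hz2 hz
  exact hz.elim hz1 hz2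

theorem apply_eq_of_not_splits (hd : ∀ β, (d β).IsValid β) {x x' : Ω → I}
    (hx : x ∈ systemSpace d) (hx' : x' ∈ systemSpace d) {a : Ω} (h : EqOn x x' (Iio a)) (ξ : Ω)
    (hs : ∀ ε, a ≤ ε → ε ≤ ξ → ¬ (d ε).Splits x) : x ξ = x' ξ := by
  induction ξ using WellFoundedLT.induction with
  | ind ξ ih =>
    rcases lt_or_ge ξ a with hξ | hξ
    · exact h hξ
    · have he : EqOn x x' (Iio (d ξ).lvl) := fun η hη =>
        ih η (hη.trans_le (hd ξ).lvl_le) fun ε h1 h2 =>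
          hs ε h1 (h2.trans (hη.trans_le (hd ξ).lvl_le).le)
      have hns := hs ξ hξ le_rfl
      rw [(hx ξ).resolve_left hns,
        (hx' ξ).resolve_left fun h => hns ((Datum.splits_congr he).2 h)]
      exact (hd ξ).congr _ _ he

theorem exists_extension (hd : ∀ β, (d β).IsValid β) (c : Ω → I) (γ : Ω) {x : Ω → I}
    (hx : ∀ ε < γ, (d ε).Splits x ∨ x ε = (d ε).fn x) :
    ∃ z ∈ systemSpace d, EqOn z x (Iio γ) ∧ ∀ ε, γ ≤ ε → (d ε).Splits z → z ε = c ε := by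
  obtain ⟨z, hz⟩ := exists_forall_of_forall_exists_below (Ω := Ω) (D := I)
    (fun β z v => (β < γ → v = x β) ∧ (γ ≤ β → ((d β).Splits z → v = c β) ∧
      (¬ (d β).Splits z → v = (d β).fn z)))
    (by
      intro β z z' v h hv
      have he : EqOn z z' (Iio (d β).lvl) := fun ε hε => h ε (hε.trans_le (hd β).lvl_le)
      rwa [← Datum.splits_congr he, ← (hd β).congr _ _ he])
    (by
      intro β z
      rcases lt_or_ge β γ with h | h
      · exact ⟨x β, fun _ => rfl, fun h' => absurd h h'.not_gt⟩
      · by_cases hs : (d β).Splits z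
        · exact ⟨c β, fun h' => absurd h h'.not_ge, fun _ => ⟨fun _ => rfl, fun h => absurd hs h⟩⟩
        · exact ⟨(d β).fn z, fun h' => absurd h h'.not_ge,
            fun _ => ⟨fun h => absurd h hs, fun _ => rfl⟩⟩)
  have hzx : EqOn z x (Iio γ) := fun ε hε => (hz ε).1 hε
  refine ⟨z, fun β => ?_, hzx, fun ε hε => ((hz ε).2 hε).1⟩
  rcases lt_or_ge β γ with h | h
  · have he : EqOn z x (Iio (d β).lvl) := hzx.mono (Iio_subset_Iio ((hd β).lvl_le.trans h.le))
    rw [Datum.splits_congr he, (hd β).congr _ _ he, hzx h]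
    exact hx β h
  · exact (em _).imp_right ((hz β).2 h).2

theorem exists_extension_apply_eq (hd : ∀ β, (d β).IsValid β) {x : Ω → I}
    (hx : x ∈ systemSpace d) {β : Ω} (hs : (d β).Splits x) (s : I) :
    ∃ z ∈ systemSpace d, EqOn z x (Iio β) ∧ z β = s := by
  obtain ⟨z, hz, hzx, hc⟩ := exists_extension hd (fun _ => s) β fun ε _ => hx ε
  exact ⟨z, hz, hzx, hc β le_rfl
    ((Datum.splits_congr (hzx.mono (Iio_subset_Iio (hd β).lvl_le))).2 hs)⟩

theorem IsCompact.exists_forall_eqOn_Iic {Z : Type} [TopologicalSpace Z] {C : Set Z}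
    (hC : IsCompact C) (hne : C.Nonempty) {u v : Z → Ω → I} (hu : Continuous u)
    (hv : Continuous v) (S : Set Ω) (h : ∀ δ ∈ S, ∃ w ∈ C, EqOn (u w) (v w) (Iic δ)) :
    ∃ w ∈ C, ∀ δ ∈ S, EqOn (u w) (v w) (Iic δ) := by
  have hN := hC.inter_iInter_nonempty (fun δ : S => {w | EqOn (u w) (v w) (Iic (δ : Ω))})
    (fun δ => isClosed_setOf_eqOn hu hv _) (fun t => by
      rcases t.eq_empty_or_nonempty with rfl | ht
      · simpa using hne
      · obtain ⟨w, hw, he⟩ := h (t.max' ht) (t.max' ht).2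
        refine ⟨w, hw, mem_iInter₂.2 fun δ hδ => he.mono (Iic_subset_Iic.2 ?_)⟩
        exact t.le_max' δ hδ)
  obtain ⟨w, hw, he⟩ := hN
  exact ⟨w, hw, fun δ hδ => mem_iInter.1 he ⟨δ, hδ⟩⟩

theorem isPreconnected_fiber (hd : ∀ β, (d β).IsValid β) (a : Ω → I) (γ : Ω) :
    IsPreconnected {x ∈ systemSpace d | EqOn x a (Iio γ)} := by
  set F := {x ∈ systemSpace d | EqOn x a (Iio γ)} with hF
  have hFc : IsClosed F := (isClosed_systemSpace hd).inter
    (isClosed_setOf_eqOn continuous_id continuous_const _)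
  rw [isPreconnected_closed_iff]
  intro t t' ht ht' hcover hne hne'
  have hC : IsCompact ((F ∩ t) ×ˢ (F ∩ t')) :=
    ((hFc.inter ht).prod (hFc.inter ht')).isCompact
  have hCne : ((F ∩ t) ×ˢ (F ∩ t')).Nonempty := hne.prod hne'
  have key : ∀ β, ∃ w ∈ (F ∩ t) ×ˢ (F ∩ t'), EqOn w.1 w.2 (Iic β) := by
    intro β
    induction β using WellFoundedLT.induction with
    | ind β ih =>
      obtain ⟨⟨x, x'⟩, ⟨hx, hx'⟩, he⟩ := hC.exists_forall_eqOn_Iic hCne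
        continuous_fst continuous_snd (Iio β) ih
      have he' : EqOn x x' (Iio β) := fun ξ hξ => he ξ hξ (mem_Iic.2 le_rfl)
      have hstep : ∀ w : (Ω → I) × (Ω → I), EqOn w.1 w.2 (Iio β) → w.1 β = w.2 β →
          EqOn w.1 w.2 (Iic β) := fun w h1 h2 ξ hξ =>
        (lt_or_eq_of_le (mem_Iic.1 hξ)).elim (fun h => h1 h) (fun h => h ▸ h2)
      rcases lt_or_ge β γ with hβ | hβ
      · exact ⟨(x, x'), ⟨hx, hx'⟩, hstep _ he' ((hx.1.2 hβ).trans (hx'.1.2 hβ).symm)⟩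
      have hel : EqOn x x' (Iio (d β).lvl) := he'.mono (Iio_subset_Iio (hd β).lvl_le)
      by_cases hs : (d β).Splits x
      · have hcl : ∀ r : Set (Ω → I), IsClosed r →
            IsClosed ((fun z : Ω → I => z β) '' ((F ∩ r) ∩ {z | EqOn z x (Iio β)})) :=
          fun r hr => (((hFc.inter hr).inter (isClosed_setOf_eqOn continuous_id
            continuous_const _)).isCompact.image (continuous_apply β)).isClosed
        obtain ⟨s, -, ⟨z, hz, hzs⟩, ⟨z', hz', hzs'⟩⟩ := isPreconnected_closed_iff.1
          (isPreconnected_univ (α := I)) _ _ (hcl t ht) (hcl t' ht') (by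
            intro s _
            obtain ⟨z, hz, hzx, hzs⟩ := exists_extension_apply_eq hd hx.1.1 hs s
            have hzF : z ∈ F := ⟨hz, (hzx.mono (Iio_subset_Iio hβ)).trans hx.1.2⟩
            exact (hcover hzF).imp (fun h => ⟨z, ⟨⟨hzF, h⟩, hzx⟩, hzs⟩)
              (fun h => ⟨z, ⟨⟨hzF, h⟩, hzx⟩, hzs⟩))
          ⟨x β, trivial, x, ⟨hx, fun _ _ => rfl⟩, rfl⟩
          ⟨x' β, trivial, x', ⟨hx', he'.symm⟩, rfl⟩
        exact ⟨(z, z'), ⟨hz.1, hz'.1⟩, hstep _ (hz.2.trans hz'.2.symm) (hzs.trans hzs'.symm)⟩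
      · refine ⟨(x, x'), ⟨hx, hx'⟩, hstep _ he' ?_⟩
        have hs' : ¬ (d β).Splits x' := fun h => hs ((Datum.splits_congr hel).2 h)
        change x β = x' β
        rw [show x β = _ from (hx.1.1 β).resolve_left hs,
          show x' β = _ from (hx'.1.1 β).resolve_left hs']
        exact (hd β).congr _ _ hel
  obtain ⟨⟨x, x'⟩, ⟨hx, hx'⟩, he⟩ := hC.exists_forall_eqOn_Iic hCne
    continuous_fst continuous_snd univ fun δ _ => key δ
  obtain rfl : x = x' := funext fun ξ => he ξ trivial (mem_Iic.2 le_rfl)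
  exact ⟨x, ⟨hx.1, hx.2, hx'.right⟩⟩

/-- The requirements on the split points of a datum at coordinate `β`, relative to the earlier
coordinates. -/
structure IsAdmissible (d : Ω → Datum Ω) (β : Ω) (e : Datum Ω) : Prop where
  valid : e.IsValid β
  cofinal : ∀ δ < e.lvl, ∃ ε < e.lvl, δ ≤ ε ∧ (d ε).Splits e.pt
  fresh : ∀ ε < β, (d ε).on → (d ε).lvl = e.lvl → ¬ EqOn e.pt (d ε).pt (Iio e.lvl)
  oscillates : ∀ ε < e.lvl, (d ε).Splits e.pt → e.Oscillates
    {z | (d ε).Splits z ∧ ∀ ε' < e.lvl, (d ε').Splits z ∨ z ε' = (d ε').fn z}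

theorem not_splits_of_lvl_le (hd : ∀ β, (d β).IsValid β)
    (ha : ∀ β, (d β).on → IsAdmissible d β (d β)) {x : Ω → I} (β : Ω) (hs : (d β).Splits x) :
    ∀ ε, (d β).lvl ≤ ε → ε < β → ¬ (d ε).Splits x := by
  induction β using WellFoundedLT.induction with
  | ind β ihβ =>
    have htransfer : ∀ η, (d η).Splits x → ∀ δ < (d η).lvl,
        ∃ ε < (d η).lvl, δ ≤ ε ∧ (d ε).Splits x := by
      intro η hη δ hδ
      obtain ⟨ε, hε, hδε, h⟩ := (ha η hη.1).cofinal δ hδ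
      refine ⟨ε, hε, hδε, (Datum.splits_congr ?_).1 h⟩
      exact (hη.2.mono (Iio_subset_Iio ((hd ε).lvl_le.trans hε.le))).symm
    intro ε
    induction ε using WellFoundedLT.induction with
    | ind ε ihε =>
      intro h1 h2 hε
      rcases lt_trichotomy (d ε).lvl (d β).lvl with h | h | h
      · obtain ⟨η, hη, hle, hηs⟩ := htransfer β hs _ h
        exact ihβ ε h2 hε η hle (hη.trans_le h1) hηs
      · refine (ha β hs.1).fresh ε h2 hε.1 h (hs.2.symm.trans ?_)
        exact h ▸ hε.2
      · obtain ⟨η, hη, hle, hηs⟩ := htransfer ε hε _ h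
        have hlt := hη.trans_le (hd ε).lvl_le
        exact ihε η hlt hle (hlt.trans h2) hηs

theorem exists_splits_lvl_eq (hd : ∀ β, (d β).IsValid β)
    (ha : ∀ β, (d β).on → IsAdmissible d β (d β)) {x : Ω → I} {α : Ω}
    (hlim : ∀ δ < α, ∃ ε < α, δ ≤ ε ∧ (d ε).Splits x) (hex : ∃ β, α ≤ β ∧ (d β).Splits x) :
    ∃ β, (d β).Splits x ∧ (d β).lvl = α := by
  have hm := WellFounded.min_mem (wellFounded_lt (α := Ω)) {β | α ≤ β ∧ (d β).Splits x} hex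
  set β := WellFounded.min (wellFounded_lt (α := Ω)) {β | α ≤ β ∧ (d β).Splits x} hex
  have hmin : ∀ ε, α ≤ ε → (d ε).Splits x → ¬ ε < β := fun ε h1 h2 =>
    WellFounded.not_lt_min (wellFounded_lt (α := Ω)) {β | α ≤ β ∧ (d β).Splits x} ⟨h1, h2⟩
  refine ⟨β, hm.2, ?_⟩
  rcases lt_trichotomy (d β).lvl α with h | h | h
  · obtain ⟨ε, hε, hle, hs⟩ := hlim _ h
    exact absurd hs (not_splits_of_lvl_le hd ha β hm.2 ε hle (hε.trans_le hm.1))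
  · exact h
  · obtain ⟨ε, hε, hle, hs⟩ := (ha β hm.2.1).cofinal α h
    refine absurd (hε.trans_le (hd β).lvl_le) (hmin ε hle ((Datum.splits_congr ?_).1 hs))
    exact (hm.2.2.mono (Iio_subset_Iio ((hd ε).lvl_le.trans hε.le))).symm

theorem exists_eqOn_Iic_of_oscillates (hd : ∀ β, (d β).IsValid β)
    (ha : ∀ β, (d β).on → IsAdmissible d β (d β)) {P : Set (Ω → I)} (hP : IsClosed P)
    (hPX : P ⊆ systemSpace d) {β : Ω} (ho : (d β).Oscillates P) {x : Ω → I}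
    (hx : x ∈ systemSpace d) (hs : (d β).Splits x) : ∃ p ∈ P, EqOn p x (Iic β) := by
  have hcl : IsClosed ((fun z : Ω → I => (cut (d β).lvl z, z β)) '' P) :=
    (hP.isCompact.image ((continuous_cut _).prodMk (continuous_apply β))).isClosed
  have hmem := ho (x β)
  have hsub : (fun z => (cut (d β).lvl z, (d β).fn z)) '' {z ∈ P | ¬ (d β).Splits z} ⊆
      (fun z : Ω → I => (cut (d β).lvl z, z β)) '' P := by
    rintro _ ⟨z, ⟨hz, hzs⟩, rfl⟩
    exact ⟨z, hz, Prod.ext rfl ((hPX hz β).resolve_left hzs)⟩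
  obtain ⟨p, hp, he⟩ := closure_minimal hsub hcl hmem
  obtain ⟨he1, he2⟩ := Prod.ext_iff.1 he
  have hpx : EqOn x p (Iio (d β).lvl) := hs.2.trans (cut_eq_cut_iff.1 he1).symm
  refine ⟨p, hp, fun ξ hξ => ?_⟩
  rcases lt_or_eq_of_le (mem_Iic.1 hξ) with h | rfl
  · exact (apply_eq_of_not_splits hd hx (hPX hp) hpx ξ fun ε h1 h2 =>
      not_splits_of_lvl_le hd ha β hs ε h1 (h2.trans_lt h)).symm
  · exact he2

/-- A closed set along which a datum oscillates contains the whole fiber over its split point. -/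
theorem mem_of_splits_of_oscillates (hd : ∀ β, (d β).IsValid β)
    (ha : ∀ β, (d β).on → IsAdmissible d β (d β)) {P : Set (Ω → I)} (hP : IsClosed P)
    (hPX : P ⊆ systemSpace d) {β : Ω} (ho : (d β).Oscillates P) {x : Ω → I}
    (hx : x ∈ systemSpace d) (hs : (d β).Splits x) : x ∈ P := by
  have hne : P.Nonempty := (exists_eqOn_Iic_of_oscillates hd ha hP hPX ho hx hs).imp
    fun _ h => h.1
  have key : ∀ δ, ∀ x ∈ systemSpace d, (d β).Splits x → ∃ p ∈ P, EqOn p x (Iic δ) := by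
    intro δ
    induction δ using WellFoundedLT.induction with
    | ind δ ih =>
      have hlow : ∀ x ∈ systemSpace d, (d β).Splits x → ∃ p ∈ P, EqOn p x (Iio δ) := by
        intro x hx hs
        obtain ⟨p, hp, he⟩ := hP.isCompact.exists_forall_eqOn_Iic hne continuous_id
          (continuous_const (y := x)) (Iio δ) fun η hη => ih η hη x hx hs
        exact ⟨p, hp, fun ξ hξ => he ξ hξ (mem_Iic.2 le_rfl)⟩
      intro x hx hs
      rcases le_or_gt δ β with hδ | hδ
      · obtain ⟨p, hp, he⟩ := exists_eqOn_Iic_of_oscillates hd ha hP hPX ho hx hs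
        exact ⟨p, hp, he.mono (Iic_subset_Iic.2 hδ)⟩
      by_cases hsδ : (d δ).Splits x
      · have hβ : β < (d δ).lvl := by
          by_contra! h
          exact not_splits_of_lvl_le hd ha δ hsδ β h hδ hs
        have hle := (hd β).lvl_le.trans hβ.le
        have hpt : (d β).Splits (d δ).pt :=
          (Datum.splits_congr (hsδ.2.mono (Iio_subset_Iio hle))).1 hs
        refine exists_eqOn_Iic_of_oscillates hd ha hP hPX ?_ hx hsδ
        refine ((ha δ hsδ.1).oscillates β hβ hpt).mono (hd δ) ?_
        rintro z ⟨hz, hzc⟩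
        obtain ⟨z', hz', he, -⟩ := exists_extension hd (fun _ => 0) (d δ).lvl hzc
        obtain ⟨p, hp, hpz⟩ := hlow z' hz'
          ((Datum.splits_congr (he.mono (Iio_subset_Iio hle))).2 hz)
        exact ⟨p, hp, he.symm.trans (hpz.mono (Iio_subset_Iio (hd δ).lvl_le)).symm⟩
      · obtain ⟨p, hp, he⟩ := hlow x hx hs
        refine ⟨p, hp, fun ξ hξ => ?_⟩
        rcases lt_or_eq_of_le (mem_Iic.1 hξ) with h | rfl
        · exact he h
        · exact (apply_eq_of_not_splits hd hx (hPX hp) he.symm ξ fun ε h1 h2 =>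
            le_antisymm h2 h1 ▸ hsδ).symm
  obtain ⟨p, hp, he⟩ := hP.isCompact.exists_forall_eqOn_Iic hne continuous_id
    (continuous_const (y := x)) univ fun η _ => key η x hx hs
  have : p = x := funext fun ξ => he ξ trivial (mem_Iic.2 le_rfl)
  exact this ▸ hp

end System

section Existence

variable {Ω : Type} [LinearOrder Ω] [WellFoundedLT Ω]

theorem IsAdmissible.of_eqOn {d d' : Ω → Datum Ω} {β : Ω} {e : Datum Ω}
    (h : ∀ ε < β, d ε = d' ε) (he : IsAdmissible d β e) : IsAdmissible d' β e := by
  have hlt : ∀ ε < e.lvl, d ε = d' ε := fun ε hε => h ε (hε.trans_le he.valid.lvl_le)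
  refine ⟨he.valid, fun δ hδ => ?_, fun ε hε => h ε hε ▸ he.fresh ε hε, fun ε hε hs s => ?_⟩
  · obtain ⟨ε, hε, hle, hs⟩ := he.cofinal δ hδ
    exact ⟨ε, hε, hle, hlt ε hε ▸ hs⟩
  · refine closure_mono (image_mono ?_) (he.oscillates ε hε (by rwa [hlt ε hε]) s)
    rintro z ⟨⟨hz, hzc⟩, hzs⟩
    rw [hlt ε hε] at hz
    refine ⟨⟨hz, fun η hη => ?_⟩, hzs⟩
    rw [← hlt η hη]
    exact hzc η hη

/-- A system can be built by recursion so that it uses an admissible datum with the property `G` at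
each coordinate where there is one. -/
theorem exists_system (G : Ω → Datum Ω → Prop) : ∃ d : Ω → Datum Ω, ∀ β, (d β).IsValid β ∧
    ((d β).on → IsAdmissible d β (d β) ∧ G β (d β)) ∧
    ∀ e : Datum Ω, e.on → IsAdmissible d β e → G β e → (d β).on := by
  have : Nonempty (Datum Ω) ∨ IsEmpty Ω := by
    rcases isEmpty_or_nonempty Ω with h | ⟨⟨a⟩⟩
    · exact Or.inr h
    · exact Or.inl ⟨⟨False, a, fun _ => 0, fun _ => 0⟩⟩
  rcases this with h | h
  · refine exists_forall_of_forall_exists_below (fun β d v => v.IsValid β ∧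
      (v.on → IsAdmissible d β v ∧ G β v) ∧
      ∀ e : Datum Ω, e.on → IsAdmissible d β e → G β e → v.on) ?_ ?_
    · rintro β d d' v h ⟨h1, h2, h3⟩
      exact ⟨h1, fun hv => ⟨(h2 hv).1.of_eqOn h, (h2 hv).2⟩,
        fun e he ha => h3 e he (ha.of_eqOn fun ε hε => (h ε hε).symm)⟩
    · intro β d
      by_cases hex : ∃ e : Datum Ω, e.on ∧ IsAdmissible d β e ∧ G β e
      · obtain ⟨e, he, ha, hg⟩ := hex
        exact ⟨e, ha.valid, fun _ => ⟨ha, hg⟩, fun _ _ _ _ => he⟩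
      · exact ⟨⟨False, β, fun _ => 0, fun _ => 0⟩,
          ⟨le_rfl, fun _ _ _ => rfl, fun _ _ => continuousAt_const⟩, fun h => h.elim,
          fun e he ha hg => hex ⟨e, he, ha, hg⟩⟩
  · exact ⟨fun a => h.elim a, fun a => h.elim a⟩

variable [∀ a : Ω, Countable (Iio a)] [Uncountable Ω]

theorem isClubSet_limitPoints {S : Set Ω} (hS : ∀ a, ∃ b ∈ S, a ≤ b) :
    IsClubSet {α | (∃ a, a < α) ∧ ∀ δ < α, ∃ ε < α, δ ≤ ε ∧ ε ∈ S} := by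
  refine ⟨fun a => ?_, fun s hs hne b hb => ?_⟩
  · have hstep : ∀ a, ∃ b ∈ S, a < b := fun a => by
      obtain ⟨c, hc⟩ := exists_gt_of_countable (countable_singleton a)
      exact (hS c).imp fun b hb => ⟨hb.1, (hc a rfl).trans_le hb.2⟩
    choose f hfS hf using hstep
    obtain ⟨c, hc⟩ := exists_gt_of_countable (countable_range fun n => f^[n] a)
    obtain ⟨α, hα⟩ := exists_isLUB_of_bddAbove
      (s := range fun n => f^[n] a) ⟨c, fun x hx => (hc x hx).le⟩
    have hlt : ∀ n, f^[n] a < α := fun n => (hf _).trans_le (by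
      rw [← Function.iterate_succ_apply' f n a]
      exact hα.1 ⟨n + 1, rfl⟩)
    refine ⟨α, ⟨⟨a, hlt 0⟩, fun δ hδ => ?_⟩, hlt 0⟩
    obtain ⟨_, ⟨n, rfl⟩, hn⟩ := (lt_isLUB_iff hα).1 hδ
    refine ⟨f (f^[n] a), ?_, hn.le.trans (hf _).le, hfS _⟩
    rw [← Function.iterate_succ_apply' f n a]
    exact hlt (n + 1)
  · have hlt : ∀ δ < b, ∃ ε < b, δ ≤ ε ∧ ε ∈ S := fun δ hδ => by
      obtain ⟨α, hα, h⟩ := (lt_isLUB_iff hb).1 hδ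
      obtain ⟨ε, hε, h'⟩ := (hs hα).2 δ h
      exact ⟨ε, hε.trans_le (hb.1 hα), h'⟩
    obtain ⟨α, hα⟩ := hne
    obtain ⟨a, ha⟩ := (hs hα).1
    exact ⟨⟨a, ha.trans_le (hb.1 hα)⟩, hlt⟩

/-- If the split points obey a prescription that is violated somewhere on each club, then every
point is split boundedly often. -/
theorem exists_forall_not_splits {C : Type} {d : Ω → Datum Ω} (hd : ∀ β, (d β).IsValid β)
    (ha : ∀ β, (d β).on → IsAdmissible d β (d β)) {F : Ω → (Ω → I) → C} {g : Ω → C}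
    (hF : ∀ γ z z', EqOn z z' (Iio γ) → F γ z = F γ z')
    (hg : ∀ z D, IsClubSet D → ∃ γ ∈ D, F γ z ≠ g γ)
    (hcol : ∀ β, (d β).on → IsMin (d β).lvl ∨ F (d β).lvl (d β).pt = g (d β).lvl) (x : Ω → I) :
    ∃ a, ∀ β, a ≤ β → ¬ (d β).Splits x := by
  by_contra! hcon
  have hcon' : ∀ a, ∃ b ∈ {β | (d β).Splits x}, a ≤ b := fun a => (hcon a).imp fun _ h => h.symm
  obtain ⟨α, ⟨⟨a, haα⟩, hα⟩, hne⟩ := hg x _ (isClubSet_limitPoints hcon')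
  obtain ⟨β, hs, rfl⟩ := exists_splits_lvl_eq hd ha hα (hcon α)
  refine hne ((hF _ _ _ hs.2).trans ((hcol β hs.1).resolve_left fun h => ?_))
  exact h.not_lt haα

end Existence

section PerfectSets

theorem accPt_principal_iff_mem_closure {Y : Type} [TopologicalSpace Y] {y : Y} {S : Set Y} :
    AccPt y (Filter.principal S) ↔ y ∈ closure (S \ {y}) := by
  rw [accPt_principal_iff_clusterPt, mem_closure_iff_clusterPt]

theorem exists_countable_preperfect {Y : Type} [TopologicalSpace Y] [FirstCountableTopology Y]
    {P : Set Y} (hP : Preperfect P) (hne : P.Nonempty) :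
    ∃ E ⊆ P, E.Countable ∧ E.Nonempty ∧ Preperfect E := by
  have hstep : ∀ x, ∃ S ⊆ P, S.Countable ∧ (x ∈ P → x ∈ closure (S \ {x})) := by
    intro x
    by_cases hx : x ∈ P
    · obtain ⟨u, hu, hlim⟩ :=
        mem_closure_iff_seq_limit.1 (accPt_principal_iff_mem_closure.1 (hP x hx))
      refine ⟨range u, range_subset_iff.2 fun n => (hu n).1, countable_range u, fun _ => ?_⟩
      exact mem_closure_of_tendsto hlim (Filter.Eventually.of_forall fun n => ⟨⟨n, rfl⟩, (hu n).2⟩)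
    · exact ⟨∅, empty_subset _, countable_empty, fun h => absurd h hx⟩
  choose S hSP hSc hS using hstep
  obtain ⟨x₀, hx₀⟩ := hne
  let E : ℕ → Set Y := fun n => n.rec {x₀} fun _ A => ⋃ x ∈ A, S x
  have hE : ∀ n, E n ⊆ P ∧ (E n).Countable := by
    intro n
    induction n with
    | zero => exact ⟨singleton_subset_iff.2 hx₀, countable_singleton x₀⟩
    | succ n ih => exact ⟨iUnion₂_subset fun x _ => hSP x, ih.2.biUnion fun x _ => hSc x⟩
  have hEP : ⋃ n, E n ⊆ P := iUnion_subset fun n => (hE n).1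
  refine ⟨⋃ n, E n, hEP, countable_iUnion fun n => (hE n).2, ⟨x₀, mem_iUnion.2 ⟨0, rfl⟩⟩,
    fun x hx => accPt_principal_iff_mem_closure.2 ?_⟩
  refine closure_mono (sdiff_subset_sdiff_left ?_) (hS x (hEP hx))
  obtain ⟨n, hn⟩ := mem_iUnion.1 hx
  exact fun z hz => mem_iUnion.2 ⟨n + 1, mem_iUnion₂.2 ⟨x, hn, hz⟩⟩

theorem not_countable_univ_nat_bool : ¬ (univ : Set (ℕ → Bool)).Countable := by
  intro h
  have h' := Cardinal.le_aleph0_iff_set_countable.2 h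
  rw [Cardinal.mk_univ] at h'
  simp only [Cardinal.mk_pi, Cardinal.mk_bool, Cardinal.prod_const, Cardinal.mk_nat,
    Cardinal.lift_id] at h'
  exact (Cardinal.cantor ℵ₀).not_ge h'

theorem Perfect.not_countable {Y : Type} [TopologicalSpace Y]
    [TopologicalSpace.IsCompletelyMetrizableSpace Y] {P : Set Y} (hP : Perfect P)
    (hne : P.Nonempty) : ¬ P.Countable := by
  let _ := TopologicalSpace.upgradeIsCompletelyMetrizable Y
  obtain ⟨f, hf, -, hinj⟩ := hP.exists_nat_bool_injection hne
  intro hc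
  exact not_countable_univ_nat_bool
    (MapsTo.countable_of_injOn (fun x _ => hf ⟨x, rfl⟩) hinj.injOn hc)

end PerfectSets

section Perfect

variable {Ω : Type} [LinearOrder Ω] [WellFoundedLT Ω] [∀ a : Ω, Countable (Iio a)]
  {d : Ω → Datum Ω}

theorem firstCountableTopology_systemSpace (hd : ∀ β, (d β).IsValid β)
    (hb : ∀ x, ∃ a, ∀ β, a ≤ β → ¬ (d β).Splits x) :
    FirstCountableTopology (systemSpace d) := by
  have : CompactSpace (systemSpace d) :=
    isCompact_iff_compactSpace.1 (isClosed_systemSpace hd).isCompact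
  refine ⟨fun x => ?_⟩
  obtain ⟨a, ha⟩ := hb x
  let f : systemSpace d → Iio a → I := fun z => cut a z
  have hf : Continuous f := (continuous_cut a).comp continuous_subtype_val
  have hinj : ∀ z, f z = f x → z = x := fun z hz => Subtype.ext (funext fun ξ =>
    (apply_eq_of_not_splits hd x.2 z.2 (cut_eq_cut_iff.1 hz).symm ξ fun ε h _ => ha ε h).symm)
  have h : 𝓝 x = Filter.comap f (𝓝 (f x)) := by
    refine le_antisymm hf.continuousAt.le_comap fun U hU => ?_
    obtain ⟨V, hVU, hV, hxV⟩ := mem_nhds_iff.1 hU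
    refine ⟨(f '' Vᶜ)ᶜ, (hf.isClosedMap _ hV.isClosed_compl).isOpen_compl.mem_nhds ?_, ?_⟩
    · rintro ⟨z, hz, he⟩
      exact hz (hinj z he ▸ hxV)
    · intro z hz
      by_contra hzU
      exact hz ⟨z, fun h => hzU (hVU h), rfl⟩
  rw [h]
  infer_instance

theorem exists_cut_image_not_countable [Uncountable Ω] [FirstCountableTopology (systemSpace d)]
    {P : Set (systemSpace d)} (hd : ∀ β, (d β).IsValid β) (hP : Perfect P) (hne : P.Nonempty) :
    ∃ γ, ¬ ((fun z : systemSpace d => cut γ (z : Ω → I)) '' P).Countable := by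
  have : CompactSpace (systemSpace d) :=
    isCompact_iff_compactSpace.1 (isClosed_systemSpace hd).isCompact
  obtain ⟨E, hEP, hEc, hEne, hE⟩ := exists_countable_preperfect hP.acc hne
  have hdiff : ∀ p : systemSpace d × systemSpace d, ∃ ξ, p.1 ≠ p.2 → p.1.1 ξ ≠ p.2.1 ξ := by
    intro p
    by_cases h : p.1 = p.2
    · obtain ⟨a⟩ : Nonempty Ω := inferInstance
      exact ⟨a, fun h' => absurd h h'⟩
    · obtain ⟨ξ, hξ⟩ := Function.ne_iff.1 fun h' => h (Subtype.ext h')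
      exact ⟨ξ, fun _ => hξ⟩
  choose ξ hξ using hdiff
  obtain ⟨γ, hγ⟩ := exists_gt_of_countable ((hEc.prod hEc).image ξ)
  refine ⟨γ, fun hc => ?_⟩
  set f : systemSpace d → Iio γ → I := fun z => cut γ z
  have hf : Continuous f := (continuous_cut γ).comp continuous_subtype_val
  have hinj : InjOn f E := by
    intro x hx y hy he
    by_contra hxy
    exact hξ (x, y) hxy (cut_eq_cut_iff.1 he (hγ _ ⟨(x, y), ⟨hx, hy⟩, rfl⟩))
  have hpre : Preperfect (f '' E) := by
    rintro _ ⟨x, hx, rfl⟩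
    refine accPt_principal_iff_mem_closure.2 ?_
    refine closure_mono ?_ (image_closure_subset_closure_image hf
      ⟨x, accPt_principal_iff_mem_closure.1 (hE x hx), rfl⟩)
    rintro _ ⟨z, ⟨hz, hzx⟩, rfl⟩
    exact ⟨⟨z, hz, rfl⟩, fun h => hzx (hinj hz hx h)⟩
  refine hpre.perfect_closure.not_countable (hEne.image f).closure (hc.mono ?_)
  exact closure_minimal (image_mono hEP) (hf.isClosedMap _ hP.closed)

/-- Above an uncountable set all of whose earlier projections are countable there are many
admissible data. -/
theorem exists_isAdmissible (hd : ∀ β, (d β).IsValid β)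
    {P : Set (Ω → I)} (hP : IsClosed P) (hPX : P ⊆ systemSpace d) {γ β : Ω} (hγβ : γ ≤ β)
    (hmin : ∀ δ < γ, (cut δ '' P).Countable) {A : Set (Iio γ → I)}
    (hA : ¬ {y ∈ cut γ '' P | y ∈ A}.Countable) :
    ∃ e : Datum Ω, e.on ∧ IsAdmissible d β e ∧ e.lvl = γ ∧ cut γ e.pt ∈ A ∧ e.pt ∈ P ∧
      e.Oscillates P := by
  set K := cut γ '' P with hK
  have hKc : IsClosed K := (hP.isCompact.image (continuous_cut γ)).isClosed
  obtain ⟨V, D, hV, hD, hKVD⟩ := exists_countable_union_perfect_of_isClosed hKc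
  let N : Iio γ → Set (Iio γ → I) := fun δ =>
    cut γ '' {x ∈ P | ∀ ε, (δ : Ω) ≤ ε → ε < γ → ¬ (d ε).Splits x}
  have hN : ∀ δ, (N δ).Countable := by
    intro δ
    let r : (Iio γ → I) → Iio (δ : Ω) → I := fun y ξ => y ⟨ξ, lt_trans ξ.2 δ.2⟩
    refine MapsTo.countable_of_injOn (f := r) (t := cut (δ : Ω) '' P) ?_ ?_ (hmin δ δ.2)
    · rintro _ ⟨x, hx, rfl⟩
      exact ⟨x, hx.1, rfl⟩
    · rintro _ ⟨x, hx, rfl⟩ _ ⟨x', hx', rfl⟩ he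
      refine cut_eq_cut_iff.2 fun ξ hξ => ?_
      exact apply_eq_of_not_splits hd (hPX hx.1) (hPX hx'.1) (cut_eq_cut_iff (γ := (δ : Ω)).1 he) ξ
        fun ε h1 h2 => hx.2 ε h1 (h2.trans_lt hξ)
  have hbad : (V ∪ (⋃ δ, N δ) ∪ range fun ε : Iio β => cut γ (d ε).pt).Countable :=
    (hV.union (countable_iUnion hN)).union (countable_range _)
  obtain ⟨_, ⟨⟨x, hx, rfl⟩, hxA⟩, hxbad⟩ := not_subset.1 fun h => hA (hbad.mono h)
  simp only [mem_union, not_or] at hxbad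
  obtain ⟨⟨hxV, hxN⟩, hxr⟩ := hxbad
  set y := cut γ x
  have hyK : y ∈ K := ⟨x, hx, rfl⟩
  have hyD : y ∈ closure (K \ {y}) := by
    have h : y ∈ D := (hKVD ▸ hyK : y ∈ V ∪ D).resolve_left hxV
    refine closure_mono (sdiff_subset_sdiff_left ?_)
      (accPt_principal_iff_mem_closure.1 (hD.acc y h))
    exact hKVD ▸ subset_union_right
  let M : Ω → Set (Ω → I) := fun ε =>
    {z | (d ε).Splits z ∧ ∀ ε' < γ, (d ε').Splits z ∨ z ε' = (d ε').fn z}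
  let L : Option {ε // ε < γ ∧ (d ε).Splits x} → Set (Iio γ → I) := fun i =>
    i.elim K fun ε => cut γ '' M ε
  have : Countable {ε // ε < γ ∧ (d ε).Splits x} :=
    ((Set.to_countable (Iio γ)).mono fun ε h => h.1 : {ε | ε < γ ∧ (d ε).Splits x}.Countable)
  have hL : ∀ i, y ∈ closure (L i \ {y}) := by
    rintro (_ | ⟨ε, hε, hs⟩)
    · exact hyD
    · set T := {z ∈ systemSpace d | EqOn z (d ε).pt (Iio (d ε).lvl)}
      have hT : IsPreconnected (cut γ '' T) :=
        (isPreconnected_fiber hd _ _).image _ (continuous_cut γ).continuousOn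
      have hval : ∀ s : I, ∃ z ∈ T, z ε = s := fun s => by
        obtain ⟨z, hz, hzx, hzs⟩ := exists_extension_apply_eq hd (hPX hx) hs s
        exact ⟨z, ⟨hz, (hzx.mono (Iio_subset_Iio (hd ε).lvl_le)).trans hs.2⟩, hzs⟩
      obtain ⟨z, hz, hz0⟩ := hval 0
      obtain ⟨z', hz', hz1⟩ := hval 1
      have hnt : (cut γ '' T).Nontrivial := ⟨_, ⟨z, hz, rfl⟩, _, ⟨z', hz', rfl⟩, fun h => by
        have := cut_eq_cut_iff.1 h hε
        rw [hz0, hz1] at this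
        exact zero_ne_one this⟩
      refine closure_mono (sdiff_subset_sdiff_left (image_mono ?_))
        (accPt_principal_iff_mem_closure.1 (hT.preperfect_of_nontrivial hnt y ⟨x, ⟨hPX hx, hs.2⟩, rfl⟩))
      exact fun w hw => ⟨⟨hs.1, hw.2⟩, fun ε' _ => hw.1 ε'⟩
  obtain ⟨φ, hφ, hosc⟩ := exists_oscillating y L hL
  let e : Datum Ω := ⟨True, γ, x, fun z => φ (cut γ z)⟩
  have hns : ∀ z, cut γ z ≠ y ↔ ¬ e.Splits z := fun z => by
    rw [Ne, cut_eq_cut_iff]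
    exact not_congr ⟨fun h => ⟨trivial, h⟩, fun h => h.2⟩
  have hsub : ∀ (i) (S : Set (Ω → I)), L i = cut γ '' S → e.Oscillates S := by
    intro i S hi s
    refine closure_mono ?_ (hosc i s)
    rintro _ ⟨w, ⟨hw, hwy⟩, rfl⟩
    rw [hi] at hw
    obtain ⟨z, hz, rfl⟩ := hw
    exact ⟨z, ⟨hz, (hns z).1 hwy⟩, rfl⟩
  refine ⟨e, trivial, ⟨⟨hγβ, fun z z' h => congrArg φ (cut_eq_cut_iff.2 h), fun z hz => ?_⟩,
    fun δ hδ => ?_, fun ε hε _ _ h => ?_, fun ε hε hs => hsub (some ⟨ε, hε, hs⟩) _ rfl⟩, rfl, hxA,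
    hx, hsub none _ rfl⟩
  · exact (hφ _ ((hns z).2 hz)).comp (continuous_cut γ).continuousAt
  · by_contra! h
    exact hxN (mem_iUnion.2 ⟨⟨δ, hδ⟩, x, ⟨hx, fun ε h1 h2 => h ε h2 h1⟩, rfl⟩)
  · exact hxr ⟨⟨ε, hε⟩, (cut_eq_cut_iff.2 h).symm⟩

theorem not_isTotallyDisconnected_of_oscillates (hd : ∀ β, (d β).IsValid β)
    (ha : ∀ β, (d β).on → IsAdmissible d β (d β)) {P : Set (Ω → I)} (hP : IsClosed P)
    (hPX : P ⊆ systemSpace d) {β : Ω} (ho : (d β).Oscillates P) {x : Ω → I}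
    (hx : x ∈ systemSpace d) (hs : (d β).Splits x) : ¬ IsTotallyDisconnected P := by
  intro htd
  have hsub := htd {z ∈ systemSpace d | EqOn z (d β).pt (Iio (d β).lvl)}
    (fun z hz => mem_of_splits_of_oscillates hd ha hP hPX ho hz.1 ⟨hs.1, hz.2⟩)
    (isPreconnected_fiber hd _ _)
  have hval : ∀ s : I, ∃ z ∈ {z ∈ systemSpace d | EqOn z (d β).pt (Iio (d β).lvl)}, z β = s :=
    fun s => by
      obtain ⟨z, hz, hzx, hzs⟩ := exists_extension_apply_eq hd hx hs s
      exact ⟨z, ⟨hz, (hzx.mono (Iio_subset_Iio (hd β).lvl_le)).trans hs.2⟩, hzs⟩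
  obtain ⟨z, hz, hz0⟩ := hval 0
  obtain ⟨z', hz', hz1⟩ := hval 1
  have := congrFun (hsub hz hz') β
  rw [hz0, hz1] at this
  exact zero_ne_one this

end Perfect

section Cardinality

theorem mk_fun_le_continuum {S T : Type} [Countable T] (hS : #S ≤ 𝔠) : #(T → S) ≤ 𝔠 :=
  calc #(T → S) = #S ^ #T := (Cardinal.power_def S T).symm
    _ ≤ 𝔠 ^ #T := Cardinal.power_le_power_right hS
    _ ≤ 𝔠 ^ ℵ₀ := Cardinal.power_le_power_left Cardinal.continuum_ne_zero Cardinal.mk_le_aleph0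
    _ = 𝔠 := Cardinal.continuum_power_aleph0

theorem mk_unitInterval : #I = 𝔠 := Cardinal.mk_Icc_real zero_lt_one

theorem mk_sigma_le_continuum {S : Type} {T : S → Type} (hS : #S ≤ 𝔠) (hT : ∀ s, #(T s) ≤ 𝔠) :
    #(Σ s, T s) ≤ 𝔠 := by
  rw [Cardinal.mk_sigma]
  refine (Cardinal.sum_le_sum _ _ hT).trans ?_
  rw [Cardinal.sum_const']
  exact (mul_le_mul_left hS _).trans Cardinal.continuum_mul_self.le

end Cardinality

section RichSystem

variable {Ω : Type} [LinearOrder Ω] [WellFoundedLT Ω] [∀ a : Ω, Countable (Iio a)] [Uncountable Ω]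

/-- A system with limit of bounded history in which some coordinate oscillates along any given
closed set with an uncountable projection. -/
theorem exists_rich_system (hΩ : #Ω = 𝔠) : ∃ d : Ω → Datum Ω, (∀ β, (d β).IsValid β) ∧
    (∀ β, (d β).on → IsAdmissible d β (d β)) ∧
    (∀ x, ∃ a, ∀ β, a ≤ β → ¬ (d β).Splits x) ∧ (∃ β, ∀ x, (d β).Splits x) ∧
    ∀ P ⊆ systemSpace d, IsClosed P → ∀ γ, ¬ (cut γ '' P).Countable →
      ∃ β, ∃ x ∈ P, (d β).Splits x ∧ (d β).Oscillates P := by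
  have hQ : ∀ γ : Ω, #(ℕ → Iio γ → I) ≤ 𝔠 := fun γ =>
    mk_fun_le_continuum (mk_fun_le_continuum mk_unitInterval.le)
  have hC : #(SegmentCode Ω) ≤ 𝔠 := mk_sigma_le_continuum hΩ.le fun δ =>
    mk_fun_le_continuum (mk_fun_le_continuum mk_unitInterval.le)
  have hlt : #(SegmentCode Ω) < #(Ω → I) := by
    refine hC.trans_lt ((Cardinal.cantor _).trans_le ?_)
    rw [← Cardinal.power_def, hΩ, mk_unitInterval]
    exact Cardinal.power_le_power_right ((Cardinal.nat_lt_continuum 2).le)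
  obtain ⟨b⟩ : Nonempty Ω := inferInstance
  have : Nonempty (SegmentCode Ω) := ⟨⟨b, fun _ _ => 0⟩⟩
  choose f hf using fun γ : Ω => exists_coloring (Ω := Ω) (Y := Iio γ → I) (C := SegmentCode Ω)
    (Q := ℕ → Iio γ → I) (hΩ ▸ hC) (hΩ ▸ hQ γ) fun q => closure (range q)
  have hF : ∀ γ z z', EqOn z z' (Iio γ) → f γ (cut γ z) = f γ (cut γ z') :=
    fun γ z z' h => congrArg (f γ) (cut_eq_cut_iff.2 h)
  obtain ⟨g, hg⟩ := exists_not_guessed_on_club hlt (fun γ z => f γ (cut γ z)) hF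
  have : Nonempty ((Σ γ : Ω, ℕ → Iio γ → I) × Ω) := ⟨⟨⟨b, fun _ _ => 0⟩, b⟩⟩
  obtain ⟨τ, hτ⟩ := exists_surjective_of_mk_le (S := Ω) (T := (Σ γ : Ω, ℕ → Iio γ → I) × Ω) (by
    rw [Cardinal.mk_prod, Cardinal.lift_id, Cardinal.lift_id, hΩ]
    exact (mul_le_mul_left (mk_sigma_le_continuum hΩ.le hQ) _).trans
      Cardinal.continuum_mul_self.le)
  have hτ' : ∀ j a, ∃ β, a ≤ β ∧ (τ β).1 = j := by
    intro j a
    have h : ¬ {β | (τ β).1 = j}.Countable := fun hc => by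
      refine not_countable (α := Ω) (countable_univ_iff.1 ((hc.image fun β => (τ β).2).mono ?_))
      intro c _
      obtain ⟨β, hβ⟩ := hτ (j, c)
      exact ⟨β, congrArg Prod.fst hβ, congrArg Prod.snd hβ⟩
    obtain ⟨β, h1, h2⟩ := exists_le_mem_of_not_countable h a
    exact ⟨β, h2, h1⟩
  let S : (Σ γ : Ω, ℕ → Iio γ → I) → Set (Ω → I) := fun j => cut j.1 ⁻¹' closure (range j.2)
  obtain ⟨d, h⟩ := exists_system (Ω := Ω) fun β e =>
    (IsMin e.lvl ∨ f e.lvl (cut e.lvl e.pt) = g e.lvl) ∧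
    (IsMin β ∨ e.lvl = (τ β).1.1 ∧ e.pt ∈ S (τ β).1 ∧ e.Oscillates (S (τ β).1))
  have hd : ∀ β, (d β).IsValid β := fun β => (h β).1
  have ha : ∀ β, (d β).on → IsAdmissible d β (d β) := fun β hβ => ((h β).2.1 hβ).1
  refine ⟨d, hd, ha, exists_forall_not_splits hd ha hF hg fun β hβ => ((h β).2.1 hβ).2.1, ?_, ?_⟩
  · let _ := WellFoundedLT.toOrderBot Ω
    have hon : (d ⊥).on := (h ⊥).2.2 ⟨True, ⊥, fun _ => 0, fun _ => 0⟩ trivial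
      ⟨⟨le_rfl, fun _ _ _ => rfl, fun _ _ => continuousAt_const⟩,
        fun δ hδ => absurd hδ not_lt_bot, fun ε hε => absurd hε not_lt_bot,
        fun ε hε => absurd hε not_lt_bot⟩ ⟨Or.inl isMin_bot, Or.inl isMin_bot⟩
    exact ⟨⊥, fun x => ⟨hon, fun ξ hξ => absurd (lt_of_lt_of_le hξ (hd ⊥).lvl_le) not_lt_bot⟩⟩
  · intro P hPX hP γ₀ hγ₀
    obtain ⟨γ, hγ, hmin⟩ : ∃ γ, ¬ (cut γ '' P).Countable ∧ ∀ δ < γ, (cut δ '' P).Countable := by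
      have hm := WellFounded.min_mem (wellFounded_lt (α := Ω)) {γ | ¬ (cut γ '' P).Countable}
        ⟨γ₀, hγ₀⟩
      refine ⟨_, hm, fun δ hδ => ?_⟩
      by_contra hc
      exact WellFounded.not_lt_min (wellFounded_lt (α := Ω)) {γ | ¬ (cut γ '' P).Countable} hc hδ
    have hKc : IsClosed (cut γ '' P) := (hP.isCompact.image (continuous_cut γ)).isClosed
    obtain ⟨t, htK, htc, hKt⟩ := (TopologicalSpace.IsSeparable.of_separableSpace
      (cut γ '' P)).exists_countable_dense_subset
    have htne : t.Nonempty := by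
      by_contra hne
      rw [not_nonempty_iff_eq_empty] at hne
      rw [hne, closure_empty] at hKt
      exact hγ (countable_empty.mono hKt)
    obtain ⟨q, rfl⟩ := htc.exists_eq_range htne
    have hK : cut γ '' P = closure (range q) := hKt.antisymm (closure_minimal htK hKc)
    obtain ⟨β, hβ, hτβ⟩ := hτ' ⟨γ, q⟩ γ
    have hSP : ∀ z, z ∈ S (τ β).1 ↔ ∃ z' ∈ P, EqOn z z' (Iio γ) := by
      intro z
      rw [hτβ]
      change cut γ z ∈ closure (range q) ↔ _
      rw [← hK]
      exact exists_congr fun z' => and_congr_right fun _ => eq_comm.trans cut_eq_cut_iff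
    have hβmin : ¬ IsMin β := fun hm => hγ <| by
      have : IsEmpty (Iio γ) := ⟨fun ξ => hm.not_lt (ξ.2.trans_le hβ)⟩
      exact (Set.to_countable _)
    obtain ⟨e, he, hea, rfl, hec, heP, heo⟩ := exists_isAdmissible hd hP hPX hβ hmin
      (A := {y | f γ y = g γ}) (by
        have := hf γ q (hK ▸ hγ) (g γ)
        rwa [← hK] at this)
    have hon := (h β).2.2 e he hea ⟨Or.inr hec, Or.inr ⟨by rw [hτβ],
      (hSP _).2 ⟨_, heP, fun _ _ => rfl⟩,
      heo.mono hea.valid fun z hz => ⟨z, (hSP z).2 ⟨z, hz, fun _ _ => rfl⟩, fun _ _ => rfl⟩⟩⟩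
    obtain ⟨hlvl, hpt, hosc⟩ := (((h β).2.1 hon).2.2).resolve_left hβmin
    rw [hτβ] at hlvl
    change (d β).lvl = e.lvl at hlvl
    obtain ⟨x, hx, hxe⟩ := (hSP _).1 hpt
    refine ⟨β, x, hx, ⟨hon, ?_⟩, hosc.mono (hd β) fun z hz => ?_⟩
    · rw [hlvl]
      exact hxe.symm
    · rw [hlvl]
      exact (hSP z).1 hz

end RichSystem

section Weight

theorem weightOf_le_mk {Y : Type} [TopologicalSpace Y] {B : Set (Set Y)}
    (hB : TopologicalSpace.IsTopologicalBasis B) : weightOf Y ≤ #B :=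
  csInf_le (OrderBot.bddBelow _) ⟨B, hB, rfl⟩

theorem weightOf_le_of_subset_pi {Ω : Type} [Infinite Ω] (S : Set (Ω → I)) : weightOf S ≤ #Ω := by
  classical
  have hb := ((isTopologicalBasis_pi fun _ : Ω =>
    TopologicalSpace.isBasis_countableBasis I).induced (Subtype.val : S → Ω → I))
  refine (weightOf_le_mk hb).trans (Cardinal.mk_image_le.trans ?_)
  let V : Finset (Ω × TopologicalSpace.countableBasis I) → Set (Ω → I) := fun t =>
    {z | ∀ p ∈ t, z p.1 ∈ (p.2 : Set I)}
  refine (Cardinal.mk_le_mk_of_subset (t := range V) ?_).trans (Cardinal.mk_range_le.trans ?_)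
  · rintro _ ⟨U, F, hU, rfl⟩
    refine ⟨F.attach.image fun i : {i // i ∈ F} => ((i : Ω), ⟨U i, hU i i.2⟩), ?_⟩
    ext z
    simp only [V, Finset.mem_image, Finset.mem_attach, true_and, Subtype.exists,
      mem_ofPred_eq, Set.mem_pi, Finset.mem_coe]
    exact ⟨fun h i hi => h _ ⟨i, hi, rfl⟩, by rintro h _ ⟨i, hi, rfl⟩; exact h i hi⟩
  · obtain ⟨u, hu, -⟩ := (TopologicalSpace.isBasis_countableBasis I).exists_subset_of_mem_open
      (mem_univ 0) isOpen_univ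
    have : Nonempty (TopologicalSpace.countableBasis I) := ⟨⟨u, hu⟩⟩
    rw [Cardinal.mk_finset_of_infinite, Cardinal.mk_prod, Cardinal.lift_id, Cardinal.lift_id]
    exact Cardinal.mul_le_of_le (Cardinal.aleph0_le_mk Ω) le_rfl
      (Cardinal.mk_le_aleph0.trans (Cardinal.aleph0_le_mk Ω))

theorem exists_perfect_isTotallyDisconnected (Y : Type) [TopologicalSpace Y] [CompactSpace Y]
    [T2Space Y] [SecondCountableTopology Y] [PreconnectedSpace Y] [Nontrivial Y] :
    ∃ P : Set Y, P.Nonempty ∧ Perfect P ∧ IsTotallyDisconnected P := by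
  let _ := TopologicalSpace.metrizableSpaceMetric Y
  have hperf : Perfect (univ : Set Y) :=
    ⟨isClosed_univ, isPreconnected_univ.preperfect_of_nontrivial nontrivial_univ⟩
  obtain ⟨f, -, hf, hinj⟩ := hperf.exists_nat_bool_injection univ_nonempty
  have he := hf.isClosedEmbedding hinj
  have htd : IsTotallyDisconnected (range f) := he.isEmbedding.isTotallyDisconnected_range.2
    inferInstance
  have hunc : ¬ (range f).Countable := fun hc =>
    not_countable_univ_nat_bool (MapsTo.countable_of_injOn (mapsTo_range f univ) hinj.injOn hc)
  obtain ⟨D, hD, hne, hsub⟩ :=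
    exists_perfect_nonempty_of_isClosed_of_not_countable he.isClosed_range hunc
  exact ⟨D, hne, hD, fun t ht => htd t (ht.trans hsub)⟩

end Weight

/-- Under CH, there is a compact, first countable, connected Hausdorff space of weight ℵ₁
with no totally disconnected perfect subsets. -/
theorem exists_compact_first_countable_connected_no_td_perfect
    (hCH : Cardinal.continuum = Cardinal.aleph 1) :
    ∃ (X : Type) (_ : TopologicalSpace X),
      CompactSpace X ∧ FirstCountableTopology X ∧ ConnectedSpace X ∧ T2Space X ∧
      weightOf X = Cardinal.aleph 1 ∧
      ¬ ∃ P : Set X, P.Nonempty ∧ Perfect P ∧ IsTotallyDisconnected P := by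
  have hCH' : Cardinal.continuum.{0} = Cardinal.aleph 1 :=
    Cardinal.lift_eq_aleph_one.1 (Cardinal.lift_continuum.{u_1, 0}.trans hCH)
  let Ω : Type := (Cardinal.aleph 1).ord.ToType
  have hΩ : #Ω = Cardinal.aleph 1 := Cardinal.mk_ord_toType _
  have hcount : ∀ a : Ω, Countable (Iio a) := fun a =>
    Cardinal.mk_le_aleph0_iff.1 (Cardinal.lt_aleph_one_iff.1
      ((Cardinal.mk_Iio_lt a (by rw [hΩ, Ordinal.type_toType])).trans_eq hΩ))
  have hunc : Uncountable Ω := by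
    rw [← Cardinal.aleph0_lt_mk_iff, hΩ]
    exact Cardinal.aleph0_lt_aleph_one
  obtain ⟨d, hd, ha, hb, ⟨β₀, hβ₀⟩, hrich⟩ := exists_rich_system (hΩ.trans hCH'.symm)
  have hcomp : CompactSpace (systemSpace d) :=
    isCompact_iff_compactSpace.1 (isClosed_systemSpace hd).isCompact
  have hfc := firstCountableTopology_systemSpace hd hb
  let _ := WellFoundedLT.toOrderBot Ω
  obtain ⟨x, hx, -⟩ := exists_extension hd (fun _ => 0) ⊥ (x := fun _ => 0)
    fun ε hε => absurd hε not_lt_bot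
  have hconn : ConnectedSpace (systemSpace d) := by
    refine isConnected_iff_connectedSpace.1 ⟨⟨x, hx⟩, ?_⟩
    convert isPreconnected_fiber hd x ⊥ using 1
    ext z
    exact ⟨fun hz => ⟨hz, fun ξ hξ => (not_lt_bot (mem_Iio.1 hξ)).elim⟩, fun hz => hz.1⟩
  have hnt : Nontrivial (systemSpace d) := by
    obtain ⟨z, hz, -, hz0⟩ := exists_extension_apply_eq hd hx (hβ₀ x) 0
    obtain ⟨z', hz', -, hz1⟩ := exists_extension_apply_eq hd hx (hβ₀ x) 1
    refine ⟨⟨z, hz⟩, ⟨z', hz'⟩, fun h => ?_⟩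
    have := congrFun (congrArg Subtype.val h) β₀
    change z β₀ = z' β₀ at this
    rw [hz0, hz1] at this
    exact zero_ne_one this
  have hno : ¬ ∃ P : Set (systemSpace d), P.Nonempty ∧ Perfect P ∧ IsTotallyDisconnected P := by
    rintro ⟨P, hne, hP, htd⟩
    have hemb := (isClosed_systemSpace hd).isClosedEmbedding_subtypeVal
    have hPc : IsClosed (Subtype.val '' P) := hemb.isClosedMap _ hP.closed
    have hPX : Subtype.val '' P ⊆ systemSpace d := image_subset_iff.2 fun z _ => z.2
    obtain ⟨γ, hγ⟩ := exists_cut_image_not_countable hd hP hne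
    obtain ⟨β, x, hxP, hs, ho⟩ := hrich _ hPX hPc γ (by rwa [image_image])
    exact not_isTotallyDisconnected_of_oscillates hd ha hPc hPX ho (hPX hxP) hs
      (hemb.isEmbedding.isTotallyDisconnected_image.2 htd)
  refine ⟨systemSpace d, inferInstance, hcomp, hfc, hconn, inferInstance, ?_, hno⟩
  refine le_antisymm ((weightOf_le_of_subset_pi _).trans hΩ.le) (le_csInf ?_ ?_)
  · exact ⟨_, _, TopologicalSpace.isTopologicalBasis_opens, rfl⟩
  · rintro _ ⟨B, hB, rfl⟩
    by_contra! hlt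
    have := hB.secondCountableTopology (Cardinal.le_aleph0_iff_set_countable.1
      (Cardinal.lt_aleph_one_iff.1 hlt))
    exact hno (exists_perfect_isTotallyDisconnected _)
end
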